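/- Let d ≥ 1 be an integer, let α ≥ 0, C0, β, L, c0, r0 > 0, 0 < μ_min ≤ μ_max < ∞ and let C ⊂ R^d be compact. Then there exists a constant C > 0 and, for each n ≥ 1, an estimator η̂*_n (a jointly measurable function of the sample and of x, with values in [0,1]) such that the plug-in classifier f̂_n* = 1{η̂*_n ≥ 1/2} satisfies sup_{P ∈ P_Σ} { E[R(f̂_n*)] − R(f*) } ≤ C n^{−β(1+α)/(2β+d)} for all n ≥ 1, where the supremum is over all P in the class P_Σ = P_Σ(α, C0, β, L, c0, r0, μ_min, μ_max, C). -/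

import Mathlib

open MeasureTheory Metric Set
open scoped ENNReal NNReal

noncomputable section

/-- Feature space: `ℝ^d` with the Euclidean norm. -/
abbrev Euc (d : ℕ) := EuclideanSpace ℝ (Fin d)

/-- A sample of size `n`: `n` points of `ℝ^d × {0,1}` (labels modelled by `Bool`). -/
abbrev Sample (d n : ℕ) := Fin n → Euc d × Bool

/-- Joint law of `(X,Y)` determined by the marginal `PX` and the regression
function `η(x) = P(Y = 1 | X = x)`. -/
def jointLaw {d : ℕ} (PX : Measure (Euc d)) (η : Euc d → ℝ) : Measure (Euc d × Bool) :=
  PX.bind fun x =>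
    ENNReal.ofReal (η x) • Measure.dirac (x, true) +
      ENNReal.ofReal (1 - η x) • Measure.dirac (x, false)

/-- Law `P^{⊗n}` of an i.i.d. sample of size `n`. -/
def sampleLaw {d : ℕ} (PX : Measure (Euc d)) (η : Euc d → ℝ) (n : ℕ) :
    Measure (Sample d n) :=
  Measure.pi fun _ => jointLaw PX η

/-- Misclassification risk `R(f) = P(Y ≠ f(X))` of a decision rule `f`. -/
def risk {d : ℕ} (PX : Measure (Euc d)) (η : Euc d → ℝ) (f : Euc d → Bool) : ℝ :=
  ∫ x, (if f x then 1 - η x else η x) ∂PX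

/-- The Bayes rule `f*(x) = 1{η(x) ≥ 1/2}`. -/
def bayes {d : ℕ} (η : Euc d → ℝ) : Euc d → Bool := fun x => decide ((1 : ℝ) / 2 ≤ η x)

/-- The plug-in rule `1{g ≥ 1/2}` associated with a function `g`. -/
def plugin {d : ℕ} (g : Euc d → ℝ) : Euc d → Bool := fun x => decide ((1 : ℝ) / 2 ≤ g x)

/-- Margin (low noise) assumption MA(α, C0):
`P_X(0 < |η(X) − 1/2| ≤ t) ≤ C0 t^α` for all `t > 0`. -/
def Margin {d : ℕ} (PX : Measure (Euc d)) (η : Euc d → ℝ) (α C0 : ℝ) : Prop :=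
  ∀ t : ℝ, 0 < t →
    PX {x | 0 < |η x - 1 / 2| ∧ |η x - 1 / 2| ≤ t} ≤ ENNReal.ofReal (C0 * t ^ α)

/-- Taylor polynomial of degree `N` of `g` at `x`, evaluated at `x'`. -/
def taylorPoly {d : ℕ} (g : Euc d → ℝ) (N : ℕ) (x x' : Euc d) : ℝ :=
  ∑ k ∈ Finset.range (N + 1), (k.factorial : ℝ)⁻¹ * iteratedFDeriv ℝ k g x (fun _ => x' - x)

/-- The Hölder class `Σ(β, L, ℝ^d)`: `g` is `⌊β⌋` times continuously differentiable
(`⌊β⌋` = largest integer strictly less than `β`, i.e. `⌈β⌉₊ - 1` for `β > 0`) and its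
Taylor polynomial of degree `⌊β⌋` approximates it to order `L‖x − x'‖^β`. -/
def HolderClass {d : ℕ} (β L : ℝ) (g : Euc d → ℝ) : Prop :=
  ContDiff ℝ (⌈β⌉₊ - 1 : ℕ) g ∧
    ∀ x x' : Euc d, |g x' - taylorPoly g (⌈β⌉₊ - 1) x x'| ≤ L * ‖x' - x‖ ^ β

/-- `(c0, r0)`-regularity of a set `A`:
`λ[A ∩ B(x,r)] ≥ c0 λ[B(x,r)]` for all `0 < r ≤ r0` and `x ∈ A`. -/
def Regular {d : ℕ} (c0 r0 : ℝ) (A : Set (Euc d)) : Prop :=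
  ∀ x ∈ A, ∀ r : ℝ, 0 < r → r ≤ r0 →
    ENNReal.ofReal c0 * volume (closedBall x r) ≤ volume (A ∩ closedBall x r)

/-- Strong density assumption with parameters `(c0, r0, μmin, μmax, K)`. -/
def StrongDensity {d : ℕ} (PX : Measure (Euc d)) (c0 r0 μmin μmax : ℝ)
    (K : Set (Euc d)) : Prop :=
  ∃ A : Set (Euc d), IsCompact A ∧ A ⊆ K ∧ Regular c0 r0 A ∧
    ∃ μ : Euc d → ℝ, Measurable μ ∧ (∀ x ∈ A, μmin ≤ μ x ∧ μ x ≤ μmax) ∧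
      (∀ x, x ∉ A → μ x = 0) ∧
      PX = volume.withDensity fun x => ENNReal.ofReal (μ x)

/-- Mild density assumption with parameters `(c0, r0, μmax, K)`. -/
def MildDensity {d : ℕ} (PX : Measure (Euc d)) (c0 r0 μmax : ℝ)
    (K : Set (Euc d)) : Prop :=
  ∃ A : Set (Euc d), IsCompact A ∧ A ⊆ K ∧ Regular c0 r0 A ∧
    ∃ μ : Euc d → ℝ, Measurable μ ∧ (∀ x ∈ A, 0 ≤ μ x ∧ μ x ≤ μmax) ∧
      (∀ x, x ∉ A → μ x = 0) ∧
      PX = volume.withDensity fun x => ENNReal.ofReal (μ x)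

/-- The class `P_Σ(α, C0, β, L, c0, r0, μmin, μmax, K)`, a distribution being encoded
by its marginal `PX` together with its regression function `η`. -/
def MemPS {d : ℕ} (α C0 β L c0 r0 μmin μmax : ℝ) (K : Set (Euc d))
    (PX : Measure (Euc d)) (η : Euc d → ℝ) : Prop :=
  IsProbabilityMeasure PX ∧ Measurable η ∧ (∀ x, η x ∈ Icc (0 : ℝ) 1) ∧
    Margin PX η α C0 ∧ HolderClass β L η ∧ StrongDensity PX c0 r0 μmin μmax K

/-- Topological support of a measure on `ℝ^d`. -/
def msupport {d : ℕ} (PX : Measure (Euc d)) : Set (Euc d) :=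
  {x | ∀ r : ℝ, 0 < r → 0 < PX (ball x r)}

/-- `f` hits the level `a` at `x0`. -/
def Hits {d : ℕ} (f : Euc d → ℝ) (a : ℝ) (x0 : Euc d) : Prop :=
  f x0 = a ∧ ∀ r : ℝ, 0 < r → ∃ x ∈ closedBall x0 r, f x ≠ a

/-- `f` crosses the level `a` at `x0`. -/
def Crosses {d : ℕ} (f : Euc d → ℝ) (a : ℝ) (x0 : Euc d) : Prop :=
  ∀ r : ℝ, 0 < r → (∃ x ∈ closedBall x0 r, f x < a) ∧ ∃ x ∈ closedBall x0 r, a < f x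

/-- Expected excess risk `E[R(f̂_n)] − R(f*)` of a plug-in classifier built from the
estimator `hatη` of the regression function. -/
def expExcess {d : ℕ} (PX : Measure (Euc d)) (η : Euc d → ℝ) {n : ℕ}
    (hatη : Sample d n → Euc d → ℝ) : ℝ :=
  (∫ ω, risk PX η (plugin (hatη ω)) ∂sampleLaw PX η n) - risk PX η (bayes η)

/-- Expected excess risk `E[R(f̂_n)] − R(f*)` of a (general) classifier. -/
def expExcessRule {d : ℕ} (PX : Measure (Euc d)) (η : Euc d → ℝ) {n : ℕ}
    (fhat : Sample d n → Euc d → Bool) : ℝ :=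
  (∫ ω, risk PX η (fhat ω) ∂sampleLaw PX η n) - risk PX η (bayes η)

/-- Empirical misclassification risk of the plug-in rule `1{g ≥ 1/2}` on a sample. -/
def empRisk {d n : ℕ} (ω : Sample d n) (g : Euc d → ℝ) : ℝ :=
  (n : ℝ)⁻¹ * ∑ i : Fin n, if plugin g (ω i).1 ≠ (ω i).2 then (1 : ℝ) else 0

/-- Tensor monomials. -/
def phi {d N : ℕ} (s : Fin d → Fin (N + 1)) (u : Fin d → ℝ) : ℝ := ∏ i, u i ^ (s i : ℕ)

/-- Tensor polynomials. -/
def tpoly {d N : ℕ} (v : (Fin d → Fin (N + 1)) → ℝ) (u : Fin d → ℝ) : ℝ := ∑ s, v s * phi s u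

lemma continuous_phi {d N : ℕ} (s : Fin d → Fin (N + 1)) : Continuous (phi s) := by
  unfold phi; fun_prop

lemma continuous_tpoly {d N : ℕ} (v : (Fin d → Fin (N + 1)) → ℝ) : Continuous (tpoly v) := by
  unfold tpoly
  exact continuous_finsetSum _ fun s _ => continuous_const.mul (continuous_phi s)

lemma uni_null {N : ℕ} (c : Fin (N + 1) → ℝ) (hc : c ≠ 0) :
    {t : ℝ | ∑ k, c k * t ^ (k : ℕ) = 0}.Finite := by
  classical
  let p : Polynomial ℝ := ∑ k : Fin (N + 1), Polynomial.C (c k) * Polynomial.X ^ (k : ℕ)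
  have hp : p ≠ 0 := by
    obtain ⟨k, hk⟩ := Function.ne_iff.1 hc
    intro h
    apply hk
    have : p.coeff k = c k := by
      simp only [p, Polynomial.finsetSum_coeff, Polynomial.coeff_C_mul_X_pow]
      rw [Finset.sum_eq_single k]
      · simp
      · intro b _ hb
        rw [if_neg]
        intro h; exact hb (Fin.ext h.symm)
      · simp
    rw [← this, h]; simp
  refine (Polynomial.finite_setOfPred_isRoot hp).subset ?_
  intro t ht
  simp only [mem_ofPred_eq, Polynomial.IsRoot, p, Polynomial.eval_finsetSum] at ht ⊢
  simpa using ht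

lemma tpoly_cons {d N : ℕ} (v : (Fin (d + 1) → Fin (N + 1)) → ℝ) (t : ℝ) (u : Fin d → ℝ) :
    tpoly v (Fin.cons t u) =
      tpoly (fun s' => ∑ k : Fin (N + 1), v (Fin.cons k s') * t ^ (k : ℕ)) u := by
  unfold tpoly
  rw [← (Fin.consEquiv (fun _ : Fin (d + 1) => Fin (N + 1))).sum_comp, Fintype.sum_prod_type_right]
  refine Finset.sum_congr rfl fun s' _ => ?_
  rw [Finset.sum_mul]
  refine Finset.sum_congr rfl fun k _ => ?_
  simp [phi, Fin.prod_univ_succ, Fin.consEquiv]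
  ring

lemma tpoly_null {N : ℕ} : ∀ {d : ℕ} (v : (Fin d → Fin (N + 1)) → ℝ), v ≠ 0 →
    volume {u : Fin d → ℝ | tpoly v u = 0} = 0 := by
  intro d
  induction d with
  | zero =>
    intro v hv
    have : {u : Fin 0 → ℝ | tpoly v u = 0} = ∅ := by
      ext u
      simp only [mem_ofPred_eq, mem_empty_iff_false, iff_false]
      intro h
      apply hv
      ext s
      rw [tpoly, Fintype.sum_subsingleton _ s] at h
      simpa only [phi, Finset.univ_eq_empty, Finset.prod_empty, mul_one, Pi.zero_apply] using h
    rw [this]; simp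
  | succ d ih =>
    intro v hv
    have e := volume_preserving_piFinSuccAbove (fun _ : Fin (d + 1) => ℝ) 0
    have hS : MeasurableSet {u : Fin (d + 1) → ℝ | tpoly v u = 0} :=
      (isClosed_singleton.preimage (continuous_tpoly v)).measurableSet
    rw [← e.symm.measure_preimage hS.nullMeasurableSet]
    have hS' := e.symm.measurable hS
    change (volume.prod volume) _ = 0
    rw [Measure.measure_prod_null hS']
    have hfin : {t : ℝ | (fun s' : Fin d → Fin (N + 1) =>
        ∑ k : Fin (N + 1), v (Fin.cons k s') * t ^ (k : ℕ)) = 0}.Finite := by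
      obtain ⟨s, hs⟩ := Function.ne_iff.1 hv
      refine (uni_null (fun k => v (Fin.cons k (Fin.tail s))) ?_).subset ?_
      · intro h
        apply hs
        have := congrFun h (s 0)
        simpa using this
      · intro t ht
        exact congrFun ht (Fin.tail s)
    have hae : ∀ᵐ t : ℝ, t ∉ {t : ℝ | (fun s' : Fin d → Fin (N + 1) =>
        ∑ k : Fin (N + 1), v (Fin.cons k s') * t ^ (k : ℕ)) = 0} := by
      exact measure_eq_zero_iff_ae_notMem.1 (hfin.measure_zero volume)
    filter_upwards [hae] with t ht
    have := ih _ ht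
    rw [Pi.zero_apply, ← this]
    congr 1
    ext u
    simp only [mem_preimage, mem_ofPred_eq]
    rw [← tpoly_cons]
    simp [MeasurableEquiv.piFinSuccAbove, Fin.insertNthEquiv]

lemma tpoly_null' {d N : ℕ} (v : (Fin d → Fin (N + 1)) → ℝ) (hv : v ≠ 0) :
    volume {u : Euc d | tpoly v u.ofLp = 0} = 0 := by
  have hS : MeasurableSet {u : Fin d → ℝ | tpoly v u = 0} :=
      (isClosed_singleton.preimage (continuous_tpoly v)).measurableSet
  rw [← tpoly_null v hv,
    ← (PiLp.volume_preserving_ofLp (Fin d)).measure_preimage hS.nullMeasurableSet]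
  rfl

lemma abs_phi_le {d N : ℕ} (s : Fin d → Fin (N + 1)) (u : Euc d)
    (hu : ‖u‖ ≤ 1) : |phi s u.ofLp| ≤ 1 := by
  unfold phi
  rw [Finset.abs_prod]
  refine Finset.prod_le_one (fun _ _ => abs_nonneg _) fun i _ => ?_
  rw [abs_pow]
  exact pow_le_one₀ (abs_nonneg _) ((PiLp.norm_apply_le u i).trans hu)

lemma tpoly_sub_le {d N : ℕ} (v w : (Fin d → Fin (N + 1)) → ℝ) (u : Euc d)
    (hu : ‖u‖ ≤ 1) : |tpoly w u.ofLp - tpoly v u.ofLp| ≤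
      Fintype.card (Fin d → Fin (N + 1)) * ‖w - v‖ := by
  unfold tpoly
  rw [← Finset.sum_sub_distrib]
  refine (Finset.abs_sum_le_sum_abs _ _).trans ?_
  rw [← nsmul_eq_mul]
  refine Finset.sum_le_card_nsmul _ _ _ fun s _ => ?_
  rw [← sub_mul, abs_mul]
  calc _ ≤ ‖w - v‖ * 1 := by
        gcongr
        · exact norm_le_pi_norm (w - v) s
        · exact abs_phi_le s u hu
    _ = _ := mul_one _

lemma small_ball (d N : ℕ) (τ : ℝ≥0∞) (hτ : 0 < τ) :
    ∃ ε : ℝ, 0 < ε ∧ ∃ T : Finset (Set (Euc d)),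
      (∀ E ∈ T, MeasurableSet E ∧ volume (closedBall (0 : Euc d) 1 \ E) ≤ τ) ∧
      ∀ w : (Fin d → Fin (N + 1)) → ℝ, ‖w‖ = 1 → ∃ E ∈ T, ∀ u ∈ E, ‖u‖ ≤ 1 →
        ε ≤ |tpoly w u.ofLp| := by
  classical
  have hcont : ∀ v : (Fin d → Fin (N + 1)) → ℝ, Continuous fun u : Euc d => tpoly v u.ofLp :=
    fun v => (continuous_tpoly v).comp (PiLp.continuous_ofLp 2 _)
  have hmeas : ∀ (v : (Fin d → Fin (N + 1)) → ℝ) (e : ℝ),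
      MeasurableSet {u : Euc d | e < |tpoly v u.ofLp|} := fun v e =>
    (isOpen_lt continuous_const (hcont v).abs).measurableSet
  have h1 : ∀ v : (Fin d → Fin (N + 1)) → ℝ, v ≠ 0 → ∃ e : ℝ, 0 < e ∧
      volume (closedBall (0 : Euc d) 1 \ {u : Euc d | e < |tpoly v u.ofLp|}) ≤ τ := by
    intro v hv
    have ht := tendsto_measure_iInter_atTop (μ := (volume : Measure (Euc d)))
      (s := fun n : ℕ => closedBall (0 : Euc d) 1 \ {u : Euc d | 1 / ((n : ℝ) + 1) < |tpoly v u.ofLp|})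
      (fun n => (measurableSet_closedBall.diff (hmeas v _)).nullMeasurableSet)
      (by
        intro m n hmn u hu
        refine ⟨hu.1, fun h => hu.2 ?_⟩
        have hmn' : (m : ℝ) ≤ n := by exact_mod_cast hmn
        have h2 : 1 / ((n : ℝ) + 1) ≤ 1 / ((m : ℝ) + 1) :=
          one_div_le_one_div_of_le (by positivity) (by linarith)
        exact lt_of_le_of_lt h2 h)
      ⟨0, ne_top_of_le_ne_top (measure_closedBall_lt_top (x := (0 : Euc d)) (r := 1)).ne
        (measure_mono sdiff_subset)⟩
    have hz : volume (⋂ n : ℕ, closedBall (0 : Euc d) 1 \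
        {u : Euc d | 1 / ((n : ℝ) + 1) < |tpoly v u.ofLp|}) = 0 := by
      refine measure_mono_null ?_ (tpoly_null' v hv)
      intro u hu
      simp only [mem_iInter, mem_sdiff, mem_ofPred_eq, not_lt] at hu
      by_contra hne
      obtain ⟨n, hn⟩ := exists_nat_one_div_lt (abs_pos.2 hne)
      exact absurd (hu n).2 (not_le.2 hn)
    rw [hz] at ht
    obtain ⟨n, hn⟩ := (ht.eventually (eventually_le_nhds hτ)).exists
    exact ⟨1 / ((n : ℝ) + 1), by positivity, hn⟩
  choose! e he hv using h1
  set D : ℝ := ((Fintype.card (Fin d → Fin (N + 1)) : ℕ) : ℝ) with hD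
  have hDpos : 0 < D := by
    rw [hD]; exact_mod_cast Fintype.card_pos
  obtain ⟨t, htS, htc⟩ := (isCompact_sphere (0 : (Fin d → Fin (N + 1)) → ℝ) 1).elim_nhds_subcover
    (fun v => ball v (e v / (2 * D))) (fun v hv => ball_mem_nhds _ (by
      have : v ≠ 0 := by rintro rfl; simp at hv
      have := he v this
      positivity))
  have hne : ∀ v ∈ t, v ≠ 0 := by
    intro v hv h
    have := htS v hv
    simp [h] at this
  have hemin : ∃ ε : ℝ, 0 < ε ∧ ∀ v ∈ t, ε ≤ e v / 2 := by
    have : ∀ t' : Finset ((Fin d → Fin (N + 1)) → ℝ), (∀ v ∈ t', v ≠ 0) →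
        ∃ ε : ℝ, 0 < ε ∧ ∀ v ∈ t', ε ≤ e v / 2 := by
      intro t'
      induction t' using Finset.induction_on with
      | empty => intro _; exact ⟨1, one_pos, by simp⟩
      | insert a s ha ih =>
        intro h
        obtain ⟨ε, hε, h'⟩ := ih (fun v hv => h v (Finset.mem_insert_of_mem hv))
        have := he a (h a (Finset.mem_insert_self _ _))
        refine ⟨min ε (e a / 2), lt_min hε (by positivity), ?_⟩
        intro v hv
        rcases Finset.mem_insert.1 hv with rfl | hv
        · exact min_le_right _ _
        · exact (min_le_left _ _).trans (h' v hv)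
    exact this t hne
  obtain ⟨ε, hε, hεt⟩ := hemin
  refine ⟨ε, hε, t.image fun v => {u : Euc d | e v < |tpoly v u.ofLp|}, ?_, ?_⟩
  · intro E hE
    obtain ⟨v, hvt, rfl⟩ := Finset.mem_image.1 hE
    exact ⟨hmeas v _, hv v (hne v hvt)⟩
  · intro w hw
    have hw' : w ∈ sphere (0 : (Fin d → Fin (N + 1)) → ℝ) 1 := by simpa using hw
    obtain ⟨v, hvt, hwv⟩ := mem_iUnion₂.1 (htc hw')
    refine ⟨_, Finset.mem_image_of_mem _ hvt, fun u hu hu1 => ?_⟩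
    simp only [mem_ofPred_eq] at hu
    have h2 := tpoly_sub_le v w u hu1
    rw [mem_ball, dist_eq_norm, lt_div_iff₀ (by positivity)] at hwv
    have h3 := hεt v hvt
    have h4 : |tpoly v u.ofLp| ≤ |tpoly w u.ofLp| + |tpoly w u.ofLp - tpoly v u.ofLp| := by
      have := abs_sub_abs_le_abs_sub (tpoly v u.ofLp) (tpoly w u.ofLp)
      rw [abs_sub_comm] at this
      linarith
    nlinarith

lemma chernoff {Ω : Type*} [MeasurableSpace Ω] (μ : Measure Ω) [IsProbabilityMeasure μ] (n : ℕ)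
    (g : Ω → ℝ) (hg : Measurable g) (hb : ∀ x, |g x| ≤ 1) (l m1 m2 s : ℝ) (hl0 : 0 ≤ l)
    (hl1 : l ≤ 1) (h1 : ∫ x, g x ∂μ ≤ m1) (h2 : ∫ x, g x ^ 2 ∂μ ≤ m2) :
    (Measure.pi fun _ : Fin n => μ).real {ω | s ≤ ∑ i, g (ω i)} ≤
      Real.exp (-(l * s) + n * (l * m1 + l ^ 2 * m2)) := by
  have hgi : Integrable g μ := by
    refine Integrable.of_bound hg.aestronglyMeasurable 1 (ae_of_all _ fun x => ?_)
    simpa using hb x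
  have hg2 : Integrable (fun x => g x ^ 2) μ := by
    refine Integrable.of_bound (hg.pow_const 2).aestronglyMeasurable 1 (ae_of_all _ fun x => ?_)
    rw [Real.norm_eq_abs, abs_pow]
    exact pow_le_one₀ (abs_nonneg _) (hb x)
  have hei : Integrable (fun x => Real.exp (l * g x)) μ := by
    refine Integrable.of_bound (by fun_prop) (Real.exp 1) (ae_of_all _ fun x => ?_)
    rw [Real.norm_eq_abs, Real.abs_exp]
    apply Real.exp_le_exp.2
    have := abs_le.1 (hb x)
    nlinarith
  have hexp : ∫ x, Real.exp (l * g x) ∂μ ≤ Real.exp (l * m1 + l ^ 2 * m2) := by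
    calc ∫ x, Real.exp (l * g x) ∂μ ≤ ∫ x, (1 + l * g x + l ^ 2 * g x ^ 2) ∂μ := by
          refine integral_mono hei (((integrable_const 1).add (hgi.const_mul l)).add
            (hg2.const_mul (l ^ 2))) fun x => ?_
          have : |l * g x| ≤ 1 := by
            rw [abs_mul, abs_of_nonneg hl0]
            exact mul_le_one₀ hl1 (abs_nonneg _) (hb x)
          have := (abs_le.1 (Real.abs_exp_sub_one_sub_id_le this)).2
          simp only
          nlinarith
      _ = 1 + l * ∫ x, g x ∂μ + l ^ 2 * ∫ x, g x ^ 2 ∂μ := by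
          have e1 : Integrable (fun x => 1 + l * g x) μ := (integrable_const 1).add (hgi.const_mul l)
          rw [integral_add e1 (hg2.const_mul (l ^ 2)), integral_add (integrable_const 1) (hgi.const_mul l), integral_const_mul,
            integral_const_mul]
          simp
      _ ≤ 1 + (l * m1 + l ^ 2 * m2) := by
          have := mul_le_mul_of_nonneg_left h1 hl0
          have := mul_le_mul_of_nonneg_left h2 (sq_nonneg l)
          linarith
      _ ≤ _ := by
          have := Real.add_one_le_exp (l * m1 + l ^ 2 * m2)
          linarith
  have hprod : ∀ ω : Fin n → Ω, Real.exp (l * ∑ i, g (ω i)) = ∏ i, Real.exp (l * g (ω i)) := by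
    intro ω
    rw [Finset.mul_sum, Real.exp_sum]
  have hI : Integrable (fun ω : Fin n → Ω => Real.exp (l * ∑ i, g (ω i)))
      (Measure.pi fun _ : Fin n => μ) := by
    simp_rw [hprod]
    exact Integrable.fintype_prod (f := fun _ x => Real.exp (l * g x)) (fun _ => hei)
  have hM := ProbabilityTheory.measure_ge_le_exp_mul_mgf (μ := Measure.pi fun _ : Fin n => μ)
    (X := fun ω => ∑ i, g (ω i)) s hl0 hI
  refine hM.trans ?_
  have : ProbabilityTheory.mgf (fun ω : Fin n → Ω => ∑ i, g (ω i)) (Measure.pi fun _ : Fin n => μ) l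
      = (∫ x, Real.exp (l * g x) ∂μ) ^ n := by
    unfold ProbabilityTheory.mgf
    simp_rw [hprod]
    rw [integral_fintype_prod_eq_pow (fun x => Real.exp (l * g x))]
    simp
  rw [this, Real.exp_add, Real.exp_nat_mul, neg_mul]
  gcongr

section joint
variable {d : ℕ} (PX : Measure (Euc d)) [IsProbabilityMeasure PX] (η : Euc d → ℝ)
  (hη : Measurable η) (h01 : ∀ x, η x ∈ Icc (0 : ℝ) 1)

lemma jointLaw_eq (hη : Measurable η) : jointLaw PX η =
    (PX.withDensity fun x => ENNReal.ofReal (η x)).map (fun x => (x, true)) +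
    (PX.withDensity fun x => ENNReal.ofReal (1 - η x)).map (fun x => (x, false)) := by
  have hm : Measurable fun x : Euc d =>
    ENNReal.ofReal (η x) • Measure.dirac (x, true) +
      ENNReal.ofReal (1 - η x) • Measure.dirac (x, false) := by
    refine Measure.measurable_of_measurable_coe _ fun s hs => ?_
    simp only [Measure.coe_add, Pi.add_apply, Measure.smul_apply, smul_eq_mul,
      Measure.dirac_apply' _ hs]
    refine (hη.ennreal_ofReal.mul ?_).add ((measurable_const.sub hη).ennreal_ofReal.mul ?_)
    · exact (measurable_one.indicator hs).comp (measurable_id.prodMk measurable_const)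
    · exact (measurable_one.indicator hs).comp (measurable_id.prodMk measurable_const)
  ext s hs
  have m1 : Measurable fun x : Euc d => (x, true) := measurable_id.prodMk measurable_const
  have m2 : Measurable fun x : Euc d => (x, false) := measurable_id.prodMk measurable_const
  rw [jointLaw, Measure.bind_apply hs hm.aemeasurable, Measure.add_apply,
    Measure.map_apply m1 hs, Measure.map_apply m2 hs,
    withDensity_apply _ (m1 hs), withDensity_apply _ (m2 hs),
    ← lintegral_indicator (m1 hs), ← lintegral_indicator (m2 hs), ← lintegral_add_left]
  · refine lintegral_congr fun x => ?_
    simp only [Measure.coe_add, Pi.add_apply, Measure.smul_apply, smul_eq_mul,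
      Measure.dirac_apply' _ hs]
    congr 1
    · by_cases h : (x, true) ∈ s <;> simp [indicator, h]
    · by_cases h : (x, false) ∈ s <;> simp [indicator, h]
  · exact hη.ennreal_ofReal.indicator (m1 hs)

lemma jointLaw_prob (hη : Measurable η) (h01 : ∀ x, η x ∈ Icc (0 : ℝ) 1) :
    IsProbabilityMeasure (jointLaw PX η) := by
  have m1 : Measurable fun x : Euc d => (x, true) := measurable_id.prodMk measurable_const
  have m2 : Measurable fun x : Euc d => (x, false) := measurable_id.prodMk measurable_const
  constructor
  rw [jointLaw_eq PX η hη, Measure.add_apply, Measure.map_apply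
    m1 MeasurableSet.univ, Measure.map_apply m2 MeasurableSet.univ]
  simp only [preimage_univ]
  rw [withDensity_apply _ .univ, withDensity_apply _ .univ, ← lintegral_add_left
    hη.ennreal_ofReal]
  rw [lintegral_congr (g := fun _ => 1)]
  · simp
  · intro x
    rw [← ENNReal.ofReal_add (h01 x).1 (by linarith [(h01 x).2])]
    simp

lemma integral_jointLaw (hη : Measurable η) (h01 : ∀ x, η x ∈ Icc (0 : ℝ) 1)
    (g : Euc d × Bool → ℝ) (hg : Measurable g) (hb : ∀ z, |g z| ≤ 1) :
    ∫ z, g z ∂(jointLaw PX η) = ∫ x, (η x * g (x, true) + (1 - η x) * g (x, false)) ∂PX := by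
  have m1 : Measurable fun x : Euc d => (x, true) := measurable_id.prodMk measurable_const
  have m2 : Measurable fun x : Euc d => (x, false) := measurable_id.prodMk measurable_const
  have := jointLaw_prob PX η hη h01
  have hη1 : Measurable fun x => ENNReal.ofReal (1 - η x) :=
    (measurable_const.sub hη).ennreal_ofReal
  have hi : Integrable g (jointLaw PX η) :=
    Integrable.of_bound hg.aestronglyMeasurable 1 (ae_of_all _ fun z => by simpa using hb z)
  rw [jointLaw_eq PX η hη] at hi ⊢
  rw [integrable_add_measure] at hi
  rw [integral_add_measure hi.1 hi.2, integral_map m1.aemeasurable hg.aestronglyMeasurable,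
    integral_map m2.aemeasurable hg.aestronglyMeasurable,
    integral_withDensity_eq_integral_toReal_smul hη.ennreal_ofReal (by simp),
    integral_withDensity_eq_integral_toReal_smul hη1 (by simp),
    ← integral_add]
  · refine integral_congr_ae (ae_of_all _ fun x => ?_)
    simp only [smul_eq_mul]
    rw [ENNReal.toReal_ofReal (h01 x).1, ENNReal.toReal_ofReal (by linarith [(h01 x).2])]
  · refine Integrable.of_bound (C := 1) ?_ (ae_of_all _ fun x => ?_)
    · exact (hη.ennreal_ofReal.ennreal_toReal.mul (hg.comp m1)).aestronglyMeasurable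
    · rw [smul_eq_mul, ENNReal.toReal_ofReal (h01 x).1, norm_mul]
      refine mul_le_one₀ ?_ (norm_nonneg _) (hb _)
      rw [Real.norm_eq_abs, abs_of_nonneg (h01 x).1]; exact (h01 x).2
  · refine Integrable.of_bound (C := 1) ?_ (ae_of_all _ fun x => ?_)
    · exact (hη1.ennreal_toReal.mul
        (hg.comp m2)).aestronglyMeasurable
    · have h0 : 0 ≤ 1 - η x := by linarith [(h01 x).2]
      rw [smul_eq_mul, ENNReal.toReal_ofReal h0, norm_mul]
      refine mul_le_one₀ ?_ (norm_nonneg _) (hb _)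
      rw [Real.norm_eq_abs, abs_of_nonneg h0]; linarith [(h01 x).1]

lemma integral_jointLaw_fst (hη : Measurable η) (h01 : ∀ x, η x ∈ Icc (0 : ℝ) 1)
    (g : Euc d → ℝ) (hg : Measurable g) (hb : ∀ z, |g z| ≤ 1) :
    ∫ z, g z.1 ∂(jointLaw PX η) = ∫ x, g x ∂PX := by
  rw [integral_jointLaw PX η hη h01 (fun z => g z.1) (hg.comp measurable_fst) (fun z => hb _)]
  refine integral_congr_ae (ae_of_all _ fun x => ?_)
  simp only; ring

lemma integral_jointLaw_noise (hη : Measurable η) (h01 : ∀ x, η x ∈ Icc (0 : ℝ) 1)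
    (g : Euc d → ℝ) (hg : Measurable g) (hb : ∀ z, |g z| ≤ 1) :
    ∫ z, g z.1 * ((if z.2 then 1 else 0) - η z.1) ∂(jointLaw PX η) = 0 := by
  rw [integral_jointLaw PX η hη h01 (fun z => g z.1 * ((if z.2 then 1 else 0) - η z.1))]
  · rw [integral_eq_zero_of_ae]
    refine (ae_of_all _ fun x => ?_)
    simp only [Pi.zero_apply]
    simp; ring
  · refine (hg.comp measurable_fst).mul (Measurable.sub ?_ (hη.comp measurable_fst))
    exact (Measurable.of_discrete (f := fun b : Bool => if b then (1 : ℝ) else 0)).comp measurable_snd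
  · intro z
    rw [abs_mul]
    refine mul_le_one₀ (hb _) (abs_nonneg _) ?_
    have := h01 z.1
    rw [abs_le]
    split_ifs <;> constructor <;> linarith [this.1, this.2]

end joint

/-- Localised monomials. -/
def bphi {d N : ℕ} (h : ℝ) (s : Fin d → Fin (N + 1)) (x X : Euc d) : ℝ :=
  if ‖X - x‖ ≤ h then phi s (h⁻¹ • (X - x)).ofLp else 0

/-- The local Gram matrix. -/
def gram {d n : ℕ} (N : ℕ) (h : ℝ) (ω : Sample d n) (x : Euc d) :
    Matrix (Fin d → Fin (N + 1)) (Fin d → Fin (N + 1)) ℝ :=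
  Matrix.of fun s t => ∑ i, bphi h s x (ω i).1 * bphi h t x (ω i).1

/-- The response vector. -/
def tvec {d n : ℕ} (N : ℕ) (h : ℝ) (ω : Sample d n) (x : Euc d) (s : Fin d → Fin (N + 1)) : ℝ :=
  ∑ i, bphi h s x (ω i).1 * (if (ω i).2 then 1 else 0)

/-- The local polynomial estimator. -/
def lpe {d n : ℕ} (N : ℕ) (h : ℝ) (ω : Sample d n) (x : Euc d) : ℝ :=
  ∑ s, (gram N h ω x)⁻¹ 0 s * tvec N h ω x s

/-- Clipped estimator. -/
def lpec {d n : ℕ} (N : ℕ) (h : ℝ) (ω : Sample d n) (x : Euc d) : ℝ :=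
  max 0 (min 1 (lpe N h ω x))

lemma measurable_bphi2 {d N : ℕ} (h : ℝ) (s : Fin d → Fin (N + 1)) :
    Measurable fun p : Euc d × Euc d => bphi h s p.1 p.2 := by
  unfold bphi
  refine Measurable.ite ?_ ?_ measurable_const
  · exact measurableSet_le (by fun_prop) measurable_const
  · refine Continuous.measurable ?_
    refine (continuous_phi s).comp ((PiLp.continuous_ofLp 2 _).comp ?_)
    fun_prop

lemma measurable_bphi {d N : ℕ} (h : ℝ) (s : Fin d → Fin (N + 1)) (x : Euc d) :
    Measurable fun X : Euc d => bphi h s x X := by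
  have h1 : Measurable fun X : Euc d => (x, X) := measurable_prodMk_left
  have h3 := (measurable_bphi2 h s).comp h1
  exact h3

lemma measurable_lpec {d : ℕ} (n N : ℕ) (h : ℝ) :
    Measurable (Function.uncurry (lpec (d := d) (n := n) N h)) := by
  have hX : ∀ i : Fin n, Measurable fun p : Sample d n × Euc d => (p.1 i).1 := fun i =>
    measurable_fst.comp ((measurable_pi_apply i).comp measurable_fst)
  have hY : ∀ i : Fin n, Measurable fun p : Sample d n × Euc d =>
      (if (p.1 i).2 then (1 : ℝ) else 0) := fun i =>
    (Measurable.of_discrete (f := fun b : Bool => if b then (1 : ℝ) else 0)).comp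
      (measurable_snd.comp ((measurable_pi_apply i).comp measurable_fst))
  have hb : ∀ (s : Fin d → Fin (N + 1)) (i : Fin n),
      Measurable fun p : Sample d n × Euc d => bphi h s p.2 (p.1 i).1 := by
    intro s i
    have h1 : Measurable fun p : Sample d n × Euc d => (p.2, (p.1 i).1) :=
      measurable_snd.prodMk (hX i)
    have h3 := (measurable_bphi2 h s).comp h1
    exact h3
  have hG : ∀ s t, Measurable fun p : Sample d n × Euc d => gram N h p.1 p.2 s t := fun s t => by
    have h1 : Measurable fun p : Sample d n × Euc d =>
        ∑ i, bphi h s p.2 (p.1 i).1 * bphi h t p.2 (p.1 i).1 :=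
      Finset.measurable_fun_sum _ fun i _ => (hb s i).mul (hb t i)
    exact h1
  have hT : ∀ s, Measurable fun p : Sample d n × Euc d => tvec N h p.1 p.2 s := fun s => by
    unfold tvec
    exact Finset.measurable_fun_sum _ fun i _ => (hb s i).mul (hY i)
  have hGm : Measurable fun p : Sample d n × Euc d =>
      (fun q : (Fin d → Fin (N + 1)) × (Fin d → Fin (N + 1)) => gram N h p.1 p.2 q.1 q.2) :=
    measurable_pi_iff.2 fun q => hG q.1 q.2
  have hdet : Measurable fun p : Sample d n × Euc d => (gram N h p.1 p.2).det := by
    have : Continuous fun q : (Fin d → Fin (N + 1)) × (Fin d → Fin (N + 1)) → ℝ =>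
        (Matrix.of fun s t => q (s, t)).det :=
      Continuous.matrix_det (continuous_matrix fun s t => continuous_apply (s, t))
    have h3 := this.measurable.comp hGm
    exact h3
  have hadj : ∀ s t, Measurable fun p : Sample d n × Euc d => (gram N h p.1 p.2).adjugate s t := by
    intro s t
    have : Continuous fun q : (Fin d → Fin (N + 1)) × (Fin d → Fin (N + 1)) → ℝ =>
        (Matrix.of fun s t => q (s, t)).adjugate s t :=
      (Continuous.matrix_adjugate
        (continuous_matrix fun s t => continuous_apply (s, t))).matrix_elem s t
    have h3 := this.measurable.comp hGm
    exact h3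
  have hinv : ∀ s t, Measurable fun p : Sample d n × Euc d => (gram N h p.1 p.2)⁻¹ s t := by
    intro s t
    simp only [Matrix.inv_def, Matrix.smul_apply, Ring.inverse_eq_inv', smul_eq_mul]
    exact hdet.inv.mul (hadj s t)
  have : Measurable fun p : Sample d n × Euc d => lpe N h p.1 p.2 := by
    unfold lpe
    exact Finset.measurable_fun_sum _ fun s _ => (hinv 0 s).mul (hT s)
  have h4 := (measurable_const (a := (0 : ℝ))).max ((measurable_const (a := (1 : ℝ))).min this)
  exact h4

lemma abs_bphi_le {d N : ℕ} (h : ℝ) (hh : 0 < h) (s : Fin d → Fin (N + 1)) (x X : Euc d) :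
    |bphi h s x X| ≤ if ‖X - x‖ ≤ h then 1 else 0 := by
  unfold bphi
  split_ifs with hX
  · refine abs_phi_le s _ ?_
    rw [norm_smul, norm_inv, Real.norm_eq_abs, abs_of_pos hh]
    rw [inv_mul_le_iff₀ hh]; simpa using hX
  · simp

lemma sum_mul_bphi {d N : ℕ} (h : ℝ) (w : (Fin d → Fin (N + 1)) → ℝ) (x X : Euc d) :
    ∑ s, w s * bphi h s x X = if ‖X - x‖ ≤ h then tpoly w (h⁻¹ • (X - x)).ofLp else 0 := by
  unfold bphi tpoly
  split_ifs <;> simp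

lemma gram_quad {d n N : ℕ} (h : ℝ) (ω : Sample d n) (x : Euc d)
    (w : (Fin d → Fin (N + 1)) → ℝ) :
    ∑ t, (∑ s, w s * gram N h ω x s t) * w t = ∑ i, (∑ s, w s * bphi h s x (ω i).1) ^ 2 := by
  simp only [gram, Matrix.of_apply, Finset.mul_sum, Finset.sum_mul, sq]
  rw [Finset.sum_comm]
  conv_rhs => rw [Finset.sum_comm]
  refine Finset.sum_congr rfl fun s _ => ?_
  conv_rhs => rw [Finset.sum_comm]
  refine Finset.sum_congr rfl fun t _ => ?_
  refine Finset.sum_congr rfl fun i _ => ?_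
  ring

lemma lpe_bound {d n N : ℕ} (h : ℝ) (hh : 0 < h) (ω : Sample d n) (x : Euc d) (η : Euc d → ℝ)
    (m c c2 z b : ℝ) (hm : 0 < m) (hc : 0 < c) (hb : 0 ≤ b)
    (H1 : ∀ w : (Fin d → Fin (N + 1)) → ℝ, ‖w‖ = 1 →
      c * m ≤ ∑ i, (∑ s, w s * bphi h s x (ω i).1) ^ 2)
    (H2 : ∑ i, (if ‖(ω i).1 - x‖ ≤ h then (1 : ℝ) else 0) ≤ c2 * m)
    (H3 : ∀ s : Fin d → Fin (N + 1),
      |∑ i, bphi h s x (ω i).1 * ((if (ω i).2 then 1 else 0) - η (ω i).1)| ≤ z * m)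
    (v : (Fin d → Fin (N + 1)) → ℝ) (hv : v 0 = η x)
    (H4 : ∀ X : Euc d, ‖X - x‖ ≤ h → |η X - tpoly v (h⁻¹ • (X - x)).ofLp| ≤ b) :
    |lpe N h ω x - η x| ≤ (Fintype.card (Fin d → Fin (N + 1)) : ℝ) / c * (z + c2 * b) := by
  classical
  set G := gram N h ω x with hG
  have hGsymm : ∀ s t, G s t = G t s := by
    intro s t
    simp only [hG, gram, Matrix.of_apply]
    exact Finset.sum_congr rfl fun i _ => mul_comm _ _
  have H1' : ∀ w : (Fin d → Fin (N + 1)) → ℝ,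
      c * m * ‖w‖ ^ 2 ≤ ∑ t, (∑ s, w s * G s t) * w t := by
    intro w
    rw [hG, gram_quad]
    by_cases hw : w = 0
    · simp [hw]
    have hw' : 0 < ‖w‖ := norm_pos_iff.2 hw
    have h1 := H1 (‖w‖⁻¹ • w) (by rw [norm_smul, norm_inv, norm_norm, inv_mul_cancel₀ hw'.ne'])
    have h2 : ∑ i, (∑ s, (‖w‖⁻¹ • w) s * bphi h s x (ω i).1) ^ 2 =
        (‖w‖ ^ 2)⁻¹ * ∑ i, (∑ s, w s * bphi h s x (ω i).1) ^ 2 := by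
      rw [Finset.mul_sum]
      refine Finset.sum_congr rfl fun i _ => ?_
      rw [← inv_pow, ← mul_pow, Finset.mul_sum]
      congr 1
      refine Finset.sum_congr rfl fun s _ => ?_
      simp [mul_assoc]
    rw [h2, le_inv_mul_iff₀ (by positivity)] at h1
    linarith
  have hdet : IsUnit G.det := by
    rw [isUnit_iff_ne_zero]
    intro h0
    obtain ⟨w, hw, hw0⟩ := Matrix.exists_mulVec_eq_zero_iff.2 h0
    have h1 := H1' w
    have h2 : ∑ t, (∑ s, w s * G s t) * w t = 0 := by
      refine Finset.sum_eq_zero fun t _ => ?_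
      have : ∑ s, w s * G s t = (G.mulVec w) t := by
        simp only [Matrix.mulVec, dotProduct]
        exact Finset.sum_congr rfl fun s _ => by rw [hGsymm s t, mul_comm]
      rw [this, hw0]; simp
    rw [h2] at h1
    have : 0 < c * m * ‖w‖ ^ 2 := by
      have := norm_pos_iff.2 hw
      positivity
    linarith
  set a : (Fin d → Fin (N + 1)) → ℝ := fun s => G⁻¹ 0 s with ha
  have haG : ∀ t, ∑ s, a s * G s t = if (0 : Fin d → Fin (N + 1)) = t then 1 else 0 := by
    intro t
    have := congrFun (congrFun (Matrix.nonsing_inv_mul G hdet) 0) t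
    rw [Matrix.mul_apply, Matrix.one_apply] at this
    exact this
  have hrep : ∀ w : (Fin d → Fin (N + 1)) → ℝ, ∑ t, (∑ s, a s * G s t) * w t = w 0 := by
    intro w
    simp [haG]
  have hanorm : ‖a‖ ≤ 1 / (c * m) := by
    have h1 := H1' a
    rw [hrep a] at h1
    have h2 : a 0 ≤ ‖a‖ := (le_abs_self _).trans (norm_le_pi_norm a 0)
    rw [le_div_iff₀ (by positivity)]
    rcases (norm_nonneg a).eq_or_lt with h0 | h0
    · rw [← h0]; simp
    · have : ‖a‖ * (c * m * ‖a‖) ≤ ‖a‖ * 1 := by nlinarith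
      have := le_of_mul_le_mul_left this h0
      linarith
  have hdiff : lpe N h ω x - η x = ∑ s, a s * (tvec N h ω x s - ∑ t, G s t * v t) := by
    rw [← hv, ← hrep v]
    simp only [mul_sub, Finset.sum_sub_distrib]
    congr 1
    simp only [Finset.sum_mul, Finset.mul_sum]
    rw [Finset.sum_comm]
    exact Finset.sum_congr rfl fun s _ => Finset.sum_congr rfl fun t _ => by ring
  have hres : ∀ s, |tvec N h ω x s - ∑ t, G s t * v t| ≤ z * m + c2 * m * b := by
    intro s
    have e1 : ∑ t, G s t * v t = ∑ i, bphi h s x (ω i).1 * ∑ t, v t * bphi h t x (ω i).1 := by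
      simp only [hG, gram, Matrix.of_apply, Finset.sum_mul, Finset.mul_sum]
      rw [Finset.sum_comm]
      exact Finset.sum_congr rfl fun s _ => Finset.sum_congr rfl fun t _ => by ring
    have e2 : tvec N h ω x s - ∑ t, G s t * v t =
        ∑ i, bphi h s x (ω i).1 * ((if (ω i).2 then 1 else 0) - η (ω i).1) +
        ∑ i, bphi h s x (ω i).1 * (η (ω i).1 - ∑ t, v t * bphi h t x (ω i).1) := by
      rw [e1, tvec, ← Finset.sum_sub_distrib, ← Finset.sum_add_distrib]
      exact Finset.sum_congr rfl fun i _ => by ring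
    rw [e2]
    refine (abs_add_le _ _).trans (add_le_add (H3 s) ?_)
    refine (Finset.abs_sum_le_sum_abs _ _).trans ?_
    refine le_trans ?_ (mul_le_mul_of_nonneg_right H2 hb)
    rw [Finset.sum_mul]
    refine Finset.sum_le_sum fun i _ => ?_
    rw [abs_mul, sum_mul_bphi]
    have hbp := abs_bphi_le h hh s x (ω i).1
    split_ifs at hbp ⊢ with hX
    · exact mul_le_mul hbp (H4 _ hX) (abs_nonneg _) zero_le_one
    · have : |bphi h s x (ω i).1| = 0 := le_antisymm hbp (abs_nonneg _)
      rw [this]; simp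
  rw [hdiff]
  refine (Finset.abs_sum_le_sum_abs _ _).trans ?_
  have hfin : ∀ s, |a s * (tvec N h ω x s - ∑ t, G s t * v t)| ≤
      1 / (c * m) * (z * m + c2 * m * b) := by
    intro s
    rw [abs_mul]
    exact mul_le_mul ((norm_le_pi_norm a s).trans hanorm) (hres s) (abs_nonneg _) (by positivity)
  refine (Finset.sum_le_card_nsmul _ _ _ fun s _ => hfin s).trans ?_
  rw [nsmul_eq_mul, Finset.card_univ]
  apply le_of_eq
  field_simp

lemma phi_zero {d N : ℕ} (s : Fin d → Fin (N + 1)) :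
    phi s 0 = if 0 = s then 1 else 0 := by
  unfold phi
  split_ifs with h
  · subst h; simp
  · obtain ⟨i, hi⟩ := Function.ne_iff.1 h
    apply Finset.prod_eq_zero (Finset.mem_univ i)
    have : (s i : ℕ) ≠ 0 := fun h0 => hi (Fin.ext (by simpa using h0.symm))
    simp [this]

lemma tpoly_zero {d N : ℕ} (v : (Fin d → Fin (N + 1)) → ℝ) : tpoly v 0 = v 0 := by
  simp [tpoly, phi_zero]

lemma monomial_eq_phi {d N k : ℕ} (hk : k ≤ N) (r : Fin k → Fin d) :
    ∃ s : Fin d → Fin (N + 1), ∀ u : Fin d → ℝ, ∏ i, u (r i) = phi s u := by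
  classical
  refine ⟨fun j => ⟨(Finset.univ.filter fun i => r i = j).card, ?_⟩, fun u => ?_⟩
  · have := Finset.card_filter_le (Finset.univ : Finset (Fin k)) (fun i => r i = j)
    simp only [Finset.card_univ, Fintype.card_fin] at this
    omega
  · rw [← Finset.prod_fiberwise (s := Finset.univ) (g := r), phi]
    refine Finset.prod_congr rfl fun j _ => ?_
    rw [Finset.prod_congr rfl (g := fun _ => u j), Finset.prod_const]
    intro i hi
    rw [(Finset.mem_filter.1 hi).2]

/-- The linear map sending coefficients to polynomials. -/
def tpolyL (d N : ℕ) : ((Fin d → Fin (N + 1)) → ℝ) →ₗ[ℝ] ((Fin d → ℝ) → ℝ) where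
  toFun v := tpoly v
  map_add' v w := by ext u; simp [tpoly, add_mul, Finset.sum_add_distrib]
  map_smul' c w := by ext u; simp [tpoly, mul_assoc, Finset.mul_sum]

lemma phi_mem {d N : ℕ} (s : Fin d → Fin (N + 1)) : phi s ∈ LinearMap.range (tpolyL d N) := by
  refine ⟨Pi.single s 1, ?_⟩
  ext u
  simp [tpolyL, tpoly, Pi.single_apply]

lemma multilinear_mem {d N k : ℕ} (hk : k ≤ N) (M : MultilinearMap ℝ (fun _ : Fin k => Euc d) ℝ) :
    (fun u : Fin d → ℝ => M fun _ => WithLp.toLp 2 u) ∈ LinearMap.range (tpolyL d N) := by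
  have e : (fun u : Fin d → ℝ => M fun _ => WithLp.toLp 2 u) =
      ∑ r : Fin k → Fin d, (M fun i => EuclideanSpace.single (r i) (1 : ℝ)) •
        fun u : Fin d → ℝ => ∏ i, u (r i) := by
    ext u
    have hu : WithLp.toLp 2 u = ∑ j, u j • EuclideanSpace.single j (1 : ℝ) := by
      ext j
      simp [Pi.single_apply]
    rw [hu, MultilinearMap.map_sum]
    simp only [Finset.sum_apply, Pi.smul_apply, smul_eq_mul]
    refine Finset.sum_congr rfl fun r _ => ?_
    rw [MultilinearMap.map_smul_univ, smul_eq_mul, mul_comm]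
  rw [e]
  refine Submodule.sum_mem _ fun r _ => Submodule.smul_mem _ _ ?_
  obtain ⟨s, hs⟩ := monomial_eq_phi hk r
  have : (fun u : Fin d → ℝ => ∏ i, u (r i)) = phi s := funext hs
  rw [this]
  exact phi_mem s

lemma holder_local {d : ℕ} {β L : ℝ} (hβ : 0 < β) (hL : 0 < L) (η : Euc d → ℝ)
    (hη : HolderClass β L η) (x : Euc d) (h : ℝ) (hh : 0 < h) :
    ∃ v : (Fin d → Fin (⌈β⌉₊ - 1 + 1)) → ℝ, v 0 = η x ∧
      ∀ X : Euc d, ‖X - x‖ ≤ h → |η X - tpoly v (h⁻¹ • (X - x)).ofLp| ≤ L * h ^ β := by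
  set N := ⌈β⌉₊ - 1 with hN
  have hmem : (fun u : Fin d → ℝ => taylorPoly η N x (x + h • WithLp.toLp 2 u)) ∈
      LinearMap.range (tpolyL d N) := by
    have e : (fun u : Fin d → ℝ => taylorPoly η N x (x + h • WithLp.toLp 2 u)) =
      ∑ k ∈ Finset.range (N + 1), ((k.factorial : ℝ)⁻¹ * h ^ k) •
        fun u : Fin d → ℝ =>
          (iteratedFDeriv ℝ k η x).toMultilinearMap fun _ => WithLp.toLp 2 u := by
      ext u
      simp only [taylorPoly, add_sub_cancel_left, Finset.sum_apply, Pi.smul_apply, smul_eq_mul]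
      refine Finset.sum_congr rfl fun k _ => ?_
      have := (iteratedFDeriv ℝ k η x).toMultilinearMap.map_smul_univ (fun _ => h)
        (fun _ => WithLp.toLp 2 u)
      simp only [ContinuousMultilinearMap.coe_coe, Finset.prod_const, Finset.card_univ,
        Fintype.card_fin, smul_eq_mul] at this ⊢
      rw [this]; ring
    rw [e]
    refine Submodule.sum_mem _ fun k hk => Submodule.smul_mem _ _ ?_
    exact multilinear_mem (Nat.lt_succ_iff.1 (Finset.mem_range.1 hk)) _
  obtain ⟨v, hv⟩ := hmem
  have hv' : ∀ u : Fin d → ℝ, tpoly v u = taylorPoly η N x (x + h • WithLp.toLp 2 u) :=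
    fun u => congrFun hv u
  refine ⟨v, ?_, ?_⟩
  · have h1 := hη.2 x x
    rw [← hN, sub_self, norm_zero, Real.zero_rpow hβ.ne', mul_zero] at h1
    have h2 : η x = taylorPoly η N x x := sub_eq_zero.1 (abs_eq_zero.1 (le_antisymm h1 (abs_nonneg _)))
    rw [← tpoly_zero v, hv', h2]
    simp
  · intro X hX
    rw [hv']
    have : x + h • WithLp.toLp 2 (h⁻¹ • (X - x)).ofLp = X := by
      rw [WithLp.toLp_ofLp, smul_smul, mul_inv_cancel₀ hh.ne', one_smul]; abel
    rw [this]
    refine (hη.2 x X).trans ?_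
    gcongr

section events
variable {d : ℕ} (PX : Measure (Euc d)) [IsProbabilityMeasure PX] (η : Euc d → ℝ)

lemma event_lower (hη : Measurable η) (h01 : ∀ x, η x ∈ Icc (0 : ℝ) 1) (n : ℕ)
    (S : Set (Euc d)) (hS : MeasurableSet S) (p : ℝ) (hp : p ≤ PX.real S) :
    (sampleLaw PX η n).real {ω | ∑ i, S.indicator (fun _ => (1 : ℝ)) (ω i).1 ≤ n * p / 4} ≤
      Real.exp (-(n * p / 8)) := by
  have := jointLaw_prob PX η hη h01
  have hgm : Measurable (S.indicator (fun _ => (1 : ℝ))) := measurable_const.indicator hS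
  have hgb : ∀ x, |S.indicator (fun _ => (1 : ℝ)) x| ≤ 1 := by
    intro x; by_cases h : x ∈ S <;> simp [h]
  have hint : ∫ z, S.indicator (fun _ => (1 : ℝ)) z.1 ∂(jointLaw PX η) = PX.real S := by
    rw [integral_jointLaw_fst PX η hη h01 _ hgm hgb]
    exact integral_indicator_one hS
  have h := chernoff (jointLaw PX η) n (fun z => -(S.indicator (fun _ => (1 : ℝ)) z.1))
    (hgm.comp measurable_fst).neg (fun z => by rw [abs_neg]; exact hgb _) (1 / 2)
    (-PX.real S) (PX.real S) (-(n * p / 4)) (by norm_num) (by norm_num)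
    (by rw [integral_neg, hint])
    (by
      have : ∀ z : Euc d × Bool, (-(S.indicator (fun _ => (1 : ℝ)) z.1)) ^ 2 =
          S.indicator (fun _ => (1 : ℝ)) z.1 := by
        intro z; by_cases h : z.1 ∈ S <;> simp [h]
      simp_rw [this]
      exact hint.le)
  have e : {ω : Sample d n | ∑ i, S.indicator (fun _ => (1 : ℝ)) (ω i).1 ≤ n * p / 4} =
      {ω | -(n * p / 4) ≤ ∑ i, -(S.indicator (fun _ => (1 : ℝ)) (ω i).1)} := by
    ext ω
    simp only [mem_ofPred_eq, Finset.sum_neg_distrib, neg_le_neg_iff]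
  rw [e, sampleLaw]
  refine h.trans (Real.exp_le_exp.2 ?_)
  have : (n : ℝ) * p ≤ n * PX.real S := by gcongr
  nlinarith

lemma event_upper (hη : Measurable η) (h01 : ∀ x, η x ∈ Icc (0 : ℝ) 1) (n : ℕ)
    (S : Set (Euc d)) (hS : MeasurableSet S) (p : ℝ) (hp : PX.real S ≤ p) :
    (sampleLaw PX η n).real {ω | 3 * (n * p) ≤ ∑ i, S.indicator (fun _ => (1 : ℝ)) (ω i).1} ≤
      Real.exp (-(n * p)) := by
  have := jointLaw_prob PX η hη h01
  have hgm : Measurable (S.indicator (fun _ => (1 : ℝ))) := measurable_const.indicator hS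
  have hgb : ∀ x, |S.indicator (fun _ => (1 : ℝ)) x| ≤ 1 := by
    intro x; by_cases h : x ∈ S <;> simp [h]
  have hint : ∫ z, S.indicator (fun _ => (1 : ℝ)) z.1 ∂(jointLaw PX η) = PX.real S := by
    rw [integral_jointLaw_fst PX η hη h01 _ hgm hgb]
    exact integral_indicator_one hS
  have h := chernoff (jointLaw PX η) n (fun z => (S.indicator (fun _ => (1 : ℝ)) z.1))
    (hgm.comp measurable_fst) (fun z => hgb _) 1
    p p (3 * (n * p)) (by norm_num) (by norm_num)
    (by rw [hint]; exact hp)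
    (by
      have : ∀ z : Euc d × Bool, (S.indicator (fun _ => (1 : ℝ)) z.1) ^ 2 =
          S.indicator (fun _ => (1 : ℝ)) z.1 := by
        intro z; by_cases h : z.1 ∈ S <;> simp [h]
      simp_rw [this]
      exact hint.le.trans hp)
  rw [sampleLaw]
  refine h.trans (Real.exp_le_exp.2 ?_)
  nlinarith

lemma event_noise (hη : Measurable η) (h01 : ∀ x, η x ∈ Icc (0 : ℝ) 1) (n : ℕ)
    (S : Set (Euc d)) (hS : MeasurableSet S) (g : Euc d → ℝ) (hg : Measurable g)
    (hgb : ∀ x, |g x| ≤ S.indicator (fun _ => (1 : ℝ)) x)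
    (q hd z : ℝ) (hq : 0 < q) (hz : 0 ≤ z) (hzq : z ≤ q)
    (hp : PX.real S ≤ q * hd) :
    (sampleLaw PX η n).real {ω | z * (n * hd) ≤
      ∑ i, g (ω i).1 * ((if (ω i).2 then 1 else 0) - η (ω i).1)} ≤
      Real.exp (-(n * hd * z ^ 2 / (4 * q))) := by
  have := jointLaw_prob PX η hη h01
  have hgm : Measurable (S.indicator (fun _ => (1 : ℝ))) := measurable_const.indicator hS
  have hib : ∀ x, |S.indicator (fun _ => (1 : ℝ)) x| ≤ 1 := by
    intro x; by_cases h : x ∈ S <;> simp [h]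
  have hg1 : ∀ x, |g x| ≤ 1 := fun x => (hgb x).trans ((le_abs_self _).trans (hib x))
  have hint : ∫ z, S.indicator (fun _ => (1 : ℝ)) z.1 ∂(jointLaw PX η) = PX.real S := by
    rw [integral_jointLaw_fst PX η hη h01 _ hgm hib]
    exact integral_indicator_one hS
  have hYm : Measurable fun z : Euc d × Bool => ((if z.2 then (1 : ℝ) else 0) - η z.1) :=
    Measurable.sub ((Measurable.of_discrete (f := fun b : Bool => if b then (1 : ℝ) else 0)).comp
      measurable_snd) (hη.comp measurable_fst)
  have hYb : ∀ z : Euc d × Bool, |(if z.2 then (1 : ℝ) else 0) - η z.1| ≤ 1 := by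
    intro z
    have := h01 z.1
    rw [abs_le]
    split_ifs <;> constructor <;> linarith [this.1, this.2]
  have hfm : Measurable fun z : Euc d × Bool => g z.1 * ((if z.2 then (1 : ℝ) else 0) - η z.1) :=
    (hg.comp measurable_fst).mul hYm
  have hfb : ∀ z : Euc d × Bool, |g z.1 * ((if z.2 then (1 : ℝ) else 0) - η z.1)| ≤
      S.indicator (fun _ => (1 : ℝ)) z.1 := by
    intro z
    rw [abs_mul]
    calc _ ≤ |g z.1| * 1 := mul_le_mul_of_nonneg_left (hYb z) (abs_nonneg _)
      _ ≤ _ := by rw [mul_one]; exact hgb _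
  have hfb1 : ∀ z : Euc d × Bool, |g z.1 * ((if z.2 then (1 : ℝ) else 0) - η z.1)| ≤ 1 :=
    fun z => (hfb z).trans ((le_abs_self _).trans (hib _))
  have h := chernoff (jointLaw PX η) n
    (fun z => g z.1 * ((if z.2 then (1 : ℝ) else 0) - η z.1)) hfm hfb1 (z / (2 * q))
    0 (q * hd) (z * (n * hd)) (by positivity)
    (by rw [div_le_one (by positivity)]; linarith)
    (integral_jointLaw_noise PX η hη h01 g hg hg1).le
    (by
      refine le_trans ?_ (hint.le.trans hp)
      refine integral_mono ?_ ?_ fun z => ?_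
      · refine Integrable.of_bound (hfm.pow_const 2).aestronglyMeasurable 1 (ae_of_all _ fun x => ?_)
        rw [Real.norm_eq_abs, abs_pow]
        exact pow_le_one₀ (abs_nonneg _) (hfb1 x)
      · refine Integrable.of_bound (hgm.comp measurable_fst).aestronglyMeasurable 1
          (ae_of_all _ fun x => ?_)
        exact hib _
      · have h1 := hfb z
        have h2 := hfb1 z
        have h3 := abs_nonneg (g z.1 * ((if z.2 then (1 : ℝ) else 0) - η z.1))
        simp only
        rw [← sq_abs]
        nlinarith)
  rw [sampleLaw]
  refine h.trans (Real.exp_le_exp.2 (le_of_eq ?_))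
  field_simp
  ring

end events

section density
variable {d : ℕ} (PX : Measure (Euc d)) (A : Set (Euc d)) (μ : Euc d → ℝ)

lemma PX_upper (μmax : ℝ) (hAc : IsCompact A)
    (hμA : ∀ x ∈ A, μ x ≤ μmax) (hμ0 : ∀ x, x ∉ A → μ x = 0) (hmax : 0 < μmax)
    (hPX : PX = volume.withDensity fun x => ENNReal.ofReal (μ x)) (x : Euc d) (h : ℝ)
    (hh : 0 < h) :
    PX.real (closedBall x h) ≤ μmax * (volume (closedBall (0 : Euc d) 1)).toReal * h ^ d := by
  have h1 : PX (closedBall x h) ≤ ENNReal.ofReal μmax * volume (closedBall x h) := by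
    rw [hPX, withDensity_apply _ measurableSet_closedBall, ← setLIntegral_const]
    refine lintegral_mono fun y => ENNReal.ofReal_le_ofReal ?_
    by_cases hy : y ∈ A
    · exact hμA y hy
    · rw [hμ0 y hy]; exact hmax.le
  rw [Measure.addHaar_closedBall' volume _ hh.le, finrank_euclideanSpace_fin] at h1
  have hfin : ENNReal.ofReal μmax * (ENNReal.ofReal (h ^ d) * volume (closedBall (0 : Euc d) 1))
      ≠ ⊤ :=
    ENNReal.mul_ne_top ENNReal.ofReal_ne_top (ENNReal.mul_ne_top ENNReal.ofReal_ne_top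
      measure_closedBall_lt_top.ne)
  have h2 := ENNReal.toReal_mono hfin h1
  rw [ENNReal.toReal_mul, ENNReal.toReal_mul, ENNReal.toReal_ofReal hmax.le,
    ENNReal.toReal_ofReal (by positivity)] at h2
  rw [Measure.real]
  linarith

lemma PX_lower [IsProbabilityMeasure PX] (μmin c0 r0 : ℝ) (hAc : IsCompact A)
    (hreg : Regular c0 r0 A) (hc0 : 0 < c0)
    (hμA : ∀ x ∈ A, μmin ≤ μ x) (hmin : 0 < μmin)
    (hPX : PX = volume.withDensity fun x => ENNReal.ofReal (μ x)) (x : Euc d) (hx : x ∈ A) (h : ℝ)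
    (hh : 0 < h) (hr : h ≤ r0) (E : Set (Euc d)) (hE : MeasurableSet E)
    (hEv : volume (closedBall (0 : Euc d) 1 \ E) ≤
      ENNReal.ofReal (c0 * (volume (closedBall (0 : Euc d) 1)).toReal / 2)) :
    μmin * c0 * (volume (closedBall (0 : Euc d) 1)).toReal / 2 * h ^ d ≤
      PX.real {X | ‖X - x‖ ≤ h ∧ h⁻¹ • (X - x) ∈ E} := by
  set V := (volume (closedBall (0 : Euc d) 1)).toReal with hV
  have hVeq : volume (closedBall (0 : Euc d) 1) = ENNReal.ofReal V :=
    (ENNReal.ofReal_toReal measure_closedBall_lt_top.ne).symm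
  have hV0 : 0 ≤ V := ENNReal.toReal_nonneg
  set S := {X | ‖X - x‖ ≤ h ∧ h⁻¹ • (X - x) ∈ E} with hS
  have hSm : MeasurableSet S := by
    have h0 : MeasurableSet {X : Euc d | ‖X - x‖ ≤ h} :=
      measurableSet_le (by fun_prop) measurable_const
    refine h0.inter ?_
    have : Measurable fun X : Euc d => h⁻¹ • (X - x) := by fun_prop
    exact this hE
  have hreg' := hreg x hx h hh hr
  rw [Measure.addHaar_closedBall' volume _ hh.le, finrank_euclideanSpace_fin, hVeq,
    ← ENNReal.ofReal_mul (by positivity), ← ENNReal.ofReal_mul hc0.le] at hreg'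
  have hdiff : volume (closedBall x h \ S) ≤ ENNReal.ofReal (h ^ d * (c0 * V / 2)) := by
    have e : closedBall x h \ S ⊆ AffineMap.homothety x h '' ((fun u => x + u) '' (closedBall (0 : Euc d) 1 \ E)) := by
      intro X hX
      have hXn : ‖X - x‖ ≤ h := by simpa [dist_eq_norm] using hX.1
      refine ⟨x + h⁻¹ • (X - x), ⟨h⁻¹ • (X - x), ⟨?_, ?_⟩, rfl⟩, ?_⟩
      · rw [mem_closedBall_zero_iff, norm_smul, norm_inv, Real.norm_eq_abs, abs_of_pos hh,
          inv_mul_le_iff₀ hh]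
        simpa using hXn
      · intro hE'
        exact hX.2 ⟨hXn, hE'⟩
      · simp [AffineMap.homothety_apply, hh.ne']
    refine (measure_mono e).trans ?_
    rw [Measure.addHaar_image_homothety, finrank_euclideanSpace_fin, image_add_left,
      measure_preimage_add, abs_of_nonneg (by positivity), ENNReal.ofReal_mul (by positivity)]
    gcongr
  have hAS : ENNReal.ofReal (h ^ d * (c0 * V / 2)) ≤ volume (S ∩ A) := by
    have h1 : volume (A ∩ closedBall x h) ≤ volume (S ∩ A) + volume (closedBall x h \ S) := by
      refine (measure_mono ?_).trans (measure_union_le _ _)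
      intro y hy
      by_cases hyS : y ∈ S
      · exact Or.inl ⟨hyS, hy.1⟩
      · exact Or.inr ⟨hy.2, hyS⟩
    have h2 := hreg'.trans (h1.trans (add_le_add_right hdiff _))
    have h3 : c0 * (h ^ d * V) = h ^ d * (c0 * V / 2) + h ^ d * (c0 * V / 2) := by ring
    rw [h3, ENNReal.ofReal_add (by positivity) (by positivity)] at h2
    exact (ENNReal.add_le_add_iff_right ENNReal.ofReal_ne_top).1 h2
  have hPS : ENNReal.ofReal (μmin * (h ^ d * (c0 * V / 2))) ≤ PX S := by
    rw [ENNReal.ofReal_mul hmin.le]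
    calc _ ≤ ENNReal.ofReal μmin * volume (S ∩ A) := by gcongr
      _ ≤ PX (S ∩ A) := by
          rw [hPX, withDensity_apply _ (hSm.inter hAc.measurableSet), ← setLIntegral_const]
          refine setLIntegral_mono' (hSm.inter hAc.measurableSet) fun y hy => ?_
          exact ENNReal.ofReal_le_ofReal (hμA y hy.2)
      _ ≤ PX S := measure_mono inter_subset_left
  have := (ENNReal.ofReal_le_iff_le_toReal (measure_ne_top PX S)).1 hPS
  rw [Measure.real]
  linarith

end density

lemma prob_bound (d : ℕ) (β L c0 r0 μmin μmax : ℝ) (hβ : 0 < β) (hL : 0 < L) (hc0 : 0 < c0)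
    (hμmin : 0 < μmin) (hμ : μmin ≤ μmax) :
    ∃ C1 C2 Cb : ℝ, 0 < C1 ∧ 0 < C2 ∧ 0 < Cb ∧
      ∀ (PX : Measure (Euc d)) (η : Euc d → ℝ), IsProbabilityMeasure PX → Measurable η →
      (∀ x, η x ∈ Icc (0 : ℝ) 1) → HolderClass β L η →
      ∀ (A : Set (Euc d)) (μ : Euc d → ℝ), IsCompact A → Regular c0 r0 A →
      (∀ x ∈ A, μmin ≤ μ x ∧ μ x ≤ μmax) → (∀ x, x ∉ A → μ x = 0) →
      (PX = volume.withDensity fun x => ENNReal.ofReal (μ x)) →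
      ∀ x ∈ A, ∀ h : ℝ, 0 < h → h ≤ r0 → ∀ n : ℕ, 1 ≤ n → ∀ δ : ℝ, 0 < δ → δ ≤ 1 →
      Cb * h ^ β ≤ δ →
      (sampleLaw PX η n).real {ω | δ ≤ |lpec (⌈β⌉₊ - 1) h ω x - η x|} ≤
        C1 * Real.exp (-(C2 * (n * h ^ d) * δ ^ 2)) := by
  classical
  set N := ⌈β⌉₊ - 1 with hN
  set V := (volume (closedBall (0 : Euc d) 1)).toReal with hV
  have hV0 : 0 < V := ENNReal.toReal_pos (measure_closedBall_pos _ _ one_pos).ne'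
    measure_closedBall_lt_top.ne
  have hmax : 0 < μmax := hμmin.trans_le hμ
  obtain ⟨ε, hε, T, hT, hTw⟩ := small_ball d N (ENNReal.ofReal (c0 * V / 2))
    (ENNReal.ofReal_pos.2 (by positivity))
  set D : ℝ := ((Fintype.card (Fin d → Fin (N + 1)) : ℕ) : ℝ) with hD
  have hD0 : 0 < D := by rw [hD]; exact_mod_cast Fintype.card_pos
  set p0 : ℝ := μmin * c0 * V / 2 with hp0
  set p1 : ℝ := μmax * V with hp1
  have hp0' : 0 < p0 := by positivity
  have hp1' : 0 < p1 := by positivity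
  set c : ℝ := ε ^ 2 * p0 / 4 with hc
  have hc' : 0 < c := by positivity
  set z0 : ℝ := c / (4 * D) with hz0
  have hz0' : 0 < z0 := by positivity
  set q : ℝ := p1 + z0 with hq
  have hq' : 0 < q := by positivity
  set C2 : ℝ := min (p0 / 8) (min p1 (z0 ^ 2 / (4 * q))) with hC2
  have hC2' : 0 < C2 := by
    refine lt_min (by positivity) (lt_min (by positivity) (by positivity))
  refine ⟨T.card + 1 + 2 * D, C2, 2 * (D / c * (3 * p1 * L)), by positivity, hC2',
    by positivity, ?_⟩
  intro PX η hPXp hη h01 hH A μ hAc hreg hμA hμ0 hPX x hx h hh hr n hn δ hδ hδ1 hδb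
  have hjp := jointLaw_prob PX η hη h01
  have hsp : IsProbabilityMeasure (sampleLaw PX η n) := by
    unfold sampleLaw; infer_instance
  have hn0 : (0 : ℝ) < n := by exact_mod_cast hn
  set m : ℝ := n * h ^ d with hm
  have hm0 : 0 < m := by positivity
  set z : ℝ := z0 * δ with hz
  have hz' : 0 ≤ z := by positivity
  have hzq : z ≤ q := by
    have : z0 * δ ≤ z0 * 1 := by gcongr
    linarith
  set R : ℝ := Real.exp (-(C2 * m * δ ^ 2)) with hR
  have hδ2 : δ ^ 2 ≤ 1 := pow_le_one₀ hδ.le hδ1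
  -- the events
  set SE : Set (Euc d) → Set (Euc d) := fun E => {X | ‖X - x‖ ≤ h ∧ h⁻¹ • (X - x) ∈ E} with hSE
  have hSEm : ∀ E ∈ T, MeasurableSet (SE E) := by
    intro E hE
    have h0 : MeasurableSet {X : Euc d | ‖X - x‖ ≤ h} :=
      measurableSet_le (by fun_prop) measurable_const
    have h1 : Measurable fun X : Euc d => h⁻¹ • (X - x) := by fun_prop
    exact h0.inter (h1 (hT E hE).1)
  set Ev1 : Set (Euc d) → Set (Sample d n) := fun E =>
    {ω | ∑ i, (SE E).indicator (fun _ => (1 : ℝ)) (ω i).1 ≤ n * (p0 * h ^ d) / 4} with hEv1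
  set Ev2 : Set (Sample d n) :=
    {ω | 3 * (n * (p1 * h ^ d)) ≤ ∑ i, (closedBall x h).indicator (fun _ => (1 : ℝ)) (ω i).1}
    with hEv2
  set Ev3 : (Fin d → Fin (N + 1)) → Set (Sample d n) := fun s =>
    {ω | z * (n * h ^ d) ≤ ∑ i, bphi h s x (ω i).1 * ((if (ω i).2 then 1 else 0) - η (ω i).1)}
    with hEv3
  set Ev4 : (Fin d → Fin (N + 1)) → Set (Sample d n) := fun s =>
    {ω | z * (n * h ^ d) ≤ ∑ i, (-bphi h s x (ω i).1) * ((if (ω i).2 then 1 else 0) - η (ω i).1)}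
    with hEv4
  have hball : PX.real (closedBall x h) ≤ p1 * h ^ d :=
    PX_upper PX A μ μmax hAc (fun y hy => (hμA y hy).2) hμ0 hmax hPX x h hh
  have B1 : ∀ E ∈ T, (sampleLaw PX η n).real (Ev1 E) ≤ R := by
    intro E hE
    have hl := PX_lower PX A μ μmin c0 r0 hAc hreg hc0 (fun y hy => (hμA y hy).1) hμmin hPX x hx
      h hh hr E (hT E hE).1 (hT E hE).2
    refine (event_lower PX η hη h01 n (SE E) (hSEm E hE) (p0 * h ^ d) hl).trans ?_
    refine Real.exp_le_exp.2 ?_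
    have h1 : C2 * m * δ ^ 2 ≤ p0 / 8 * m * 1 := by
      gcongr
      exact min_le_left _ _
    have h2 : n * (p0 * h ^ d) / 8 = p0 / 8 * m * 1 := by rw [hm]; ring
    linarith
  have B2 : (sampleLaw PX η n).real Ev2 ≤ R := by
    refine (event_upper PX η hη h01 n _ measurableSet_closedBall _ hball).trans ?_
    refine Real.exp_le_exp.2 ?_
    have h1 : C2 * m * δ ^ 2 ≤ p1 * m * 1 := by
      gcongr
      exact (min_le_right _ _).trans (min_le_left _ _)
    have h2 : n * (p1 * h ^ d) = p1 * m * 1 := by rw [hm]; ring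
    linarith
  have hballq : PX.real (closedBall x h) ≤ q * h ^ d := by
    refine hball.trans ?_
    gcongr
    linarith
  have hbind : ∀ (s : Fin d → Fin (N + 1)) (X : Euc d),
      |bphi h s x X| ≤ (closedBall x h).indicator (fun _ => (1 : ℝ)) X := by
    intro s X
    refine (abs_bphi_le h hh s x X).trans (le_of_eq ?_)
    simp only [indicator, mem_closedBall, dist_eq_norm]
  have hexp3 : Real.exp (-(n * h ^ d * z ^ 2 / (4 * q))) ≤ R := by
    refine Real.exp_le_exp.2 ?_
    have h1 : C2 * m * δ ^ 2 ≤ z0 ^ 2 / (4 * q) * m * δ ^ 2 := by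
      gcongr
      exact (min_le_right _ _).trans (min_le_right _ _)
    have h2 : n * h ^ d * z ^ 2 / (4 * q) = z0 ^ 2 / (4 * q) * m * δ ^ 2 := by
      rw [hm, hz]; ring
    linarith
  have B3 : ∀ s, (sampleLaw PX η n).real (Ev3 s) ≤ R := fun s =>
    (event_noise PX η hη h01 n _ measurableSet_closedBall (fun X => bphi h s x X)
      (measurable_bphi h s x) (hbind s) q (h ^ d) z hq' hz' hzq hballq).trans hexp3
  have B4 : ∀ s, (sampleLaw PX η n).real (Ev4 s) ≤ R := fun s =>
    (event_noise PX η hη h01 n _ measurableSet_closedBall (fun X => -bphi h s x X)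
      (measurable_bphi h s x).neg (fun X => by rw [abs_neg]; exact hbind s X)
      q (h ^ d) z hq' hz' hzq hballq).trans hexp3
  have hsub : {ω : Sample d n | δ ≤ |lpec N h ω x - η x|} ⊆
      (⋃ E ∈ T, Ev1 E) ∪ Ev2 ∪ (⋃ s ∈ (Finset.univ : Finset (Fin d → Fin (N + 1))), Ev3 s) ∪
        (⋃ s ∈ (Finset.univ : Finset (Fin d → Fin (N + 1))), Ev4 s) := by
    intro ω hω
    by_contra hcon
    simp only [mem_union, mem_iUnion, not_or, not_exists, Finset.mem_univ] at hcon
    obtain ⟨⟨⟨n1, n2⟩, n3⟩, n4⟩ := hcon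
    obtain ⟨v, hv0, hv⟩ := holder_local hβ hL η hH x h hh
    have hbd := lpe_bound (N := N) h hh ω x η m c (3 * p1) z (L * h ^ β) hm0 hc' (by positivity)
      ?_ ?_ ?_ v hv0 hv
    · have hclip : |lpec N h ω x - η x| ≤ |lpe N h ω x - η x| := by
        unfold lpec
        have hx1 := h01 x
        rcases le_total (lpe N h ω x) 0 with hl | hl
        · rw [min_eq_right (by linarith), max_eq_left hl, abs_le]
          have := neg_abs_le (lpe N h ω x - η x)
          constructor <;> linarith [hx1.1, abs_nonneg (lpe N h ω x - η x)]
        · rcases le_total (lpe N h ω x) 1 with hl1 | hl1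
          · rw [min_eq_right hl1, max_eq_right hl]
          · rw [min_eq_left hl1, max_eq_right zero_le_one, abs_le]
            have := le_abs_self (lpe N h ω x - η x)
            constructor <;> linarith [hx1.2, abs_nonneg (lpe N h ω x - η x)]
      have hω' : δ ≤ |lpec N h ω x - η x| := hω
      have h1 : D / c * (z + 3 * p1 * (L * h ^ β)) =
          D / c * z + D / c * (3 * p1 * L) * h ^ β := by ring
      have h2 : D / c * z = δ / 4 := by
        rw [hz, hz0]; field_simp
      have h3 : δ ≤ D / c * (z + 3 * p1 * (L * h ^ β)) := hω'.trans (hclip.trans hbd)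
      rw [h1, h2] at h3
      linarith
    · intro w hw
      obtain ⟨E, hE, hEw⟩ := hTw w hw
      have h1 : n * (p0 * h ^ d) / 4 < ∑ i, (SE E).indicator (fun _ => (1 : ℝ)) (ω i).1 :=
        not_le.1 (n1 E hE)
      calc c * m = ε ^ 2 * (n * (p0 * h ^ d) / 4) := by rw [hc, hm]; ring
        _ ≤ ε ^ 2 * ∑ i, (SE E).indicator (fun _ => (1 : ℝ)) (ω i).1 := by gcongr
        _ ≤ _ := by
          rw [Finset.mul_sum]
          refine Finset.sum_le_sum fun i _ => ?_
          rw [sum_mul_bphi]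
          by_cases hi : (ω i).1 ∈ SE E
          · have hi' : ‖(ω i).1 - x‖ ≤ h ∧ h⁻¹ • ((ω i).1 - x) ∈ E := hi
            rw [indicator_of_mem hi, if_pos hi'.1, mul_one, ← sq_abs (tpoly _ _)]
            have := hEw _ hi'.2 (by
              rw [norm_smul, norm_inv, Real.norm_eq_abs, abs_of_pos hh, inv_mul_le_iff₀ hh]
              simpa using hi'.1)
            gcongr
          · rw [indicator_of_notMem hi, mul_zero]; positivity
    · have h1 : ∑ i, (closedBall x h).indicator (fun _ => (1 : ℝ)) (ω i).1 <
          3 * (n * (p1 * h ^ d)) := not_le.1 n2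
      have h2 : 3 * (n * (p1 * h ^ d)) = 3 * p1 * m := by rw [hm]; ring
      rw [← h2]
      refine le_trans (le_of_eq ?_) h1.le
      refine Finset.sum_congr rfl fun i _ => ?_
      simp only [indicator, mem_closedBall, dist_eq_norm]
    · intro s
      have h3 : ∑ i, bphi h s x (ω i).1 * ((if (ω i).2 then 1 else 0) - η (ω i).1) <
          z * (n * h ^ d) := not_le.1 (n3 s trivial)
      have h4 : ∑ i, (-bphi h s x (ω i).1) * ((if (ω i).2 then 1 else 0) - η (ω i).1) <
          z * (n * h ^ d) := not_le.1 (n4 s trivial)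
      rw [hm]
      simp only [neg_mul, Finset.sum_neg_distrib] at h4
      rw [abs_le]
      constructor <;> linarith
  refine (measureReal_mono hsub).trans ?_
  have u1 : (sampleLaw PX η n).real (⋃ E ∈ T, Ev1 E) ≤ T.card * R := by
    refine (measureReal_biUnion_finset_le _ _).trans ?_
    rw [← nsmul_eq_mul]
    exact Finset.sum_le_card_nsmul _ _ _ B1
  have u3 : (sampleLaw PX η n).real
      (⋃ s ∈ (Finset.univ : Finset (Fin d → Fin (N + 1))), Ev3 s) ≤ D * R := by
    refine (measureReal_biUnion_finset_le _ _).trans ?_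
    rw [hD, ← nsmul_eq_mul, ← Finset.card_univ]
    exact Finset.sum_le_card_nsmul _ _ _ fun s _ => B3 s
  have u4 : (sampleLaw PX η n).real
      (⋃ s ∈ (Finset.univ : Finset (Fin d → Fin (N + 1))), Ev4 s) ≤ D * R := by
    refine (measureReal_biUnion_finset_le _ _).trans ?_
    rw [hD, ← nsmul_eq_mul, ← Finset.card_univ]
    exact Finset.sum_le_card_nsmul _ _ _ fun s _ => B4 s
  have w1 := measureReal_union_le (μ := sampleLaw PX η n) ((⋃ E ∈ T, Ev1 E) ∪ Ev2 ∪
    (⋃ s ∈ (Finset.univ : Finset (Fin d → Fin (N + 1))), Ev3 s))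
    (⋃ s ∈ (Finset.univ : Finset (Fin d → Fin (N + 1))), Ev4 s)
  have w2 := measureReal_union_le (μ := sampleLaw PX η n) ((⋃ E ∈ T, Ev1 E) ∪ Ev2)
    (⋃ s ∈ (Finset.univ : Finset (Fin d → Fin (N + 1))), Ev3 s)
  have w3 := measureReal_union_le (μ := sampleLaw PX η n) (⋃ E ∈ T, Ev1 E) Ev2
  have e : ((T.card : ℝ) + 1 + 2 * D) * R = T.card * R + R + D * R + D * R := by ring
  linarith

lemma summable_peel (α κ : ℝ) (hκ : 0 < κ) :
    Summable fun j : ℕ => ((j : ℝ) + 1) ^ (1 + α) * Real.exp (-(κ * (j : ℝ) ^ 2)) := by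
  set M := ⌈1 + α⌉₊ with hM
  have h1 := (summable_nat_add_iff 1).2 (Real.summable_pow_mul_exp_neg_nat_mul M hκ)
  have h2 := h1.mul_left (Real.exp κ)
  refine Summable.of_nonneg_of_le (fun j => by positivity) (fun j => ?_) h2
  have e1 : ((j : ℝ) + 1) ^ (1 + α) ≤ ((j : ℝ) + 1) ^ M := by
    rw [← Real.rpow_natCast]
    exact Real.rpow_le_rpow_of_exponent_le (by linarith [(Nat.cast_nonneg j : (0 : ℝ) ≤ j)])
      (Nat.le_ceil _)
  have e2 : Real.exp (-(κ * (j : ℝ) ^ 2)) ≤ Real.exp κ * Real.exp (-κ * ((j + 1 : ℕ) : ℝ)) := by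
    rw [← Real.exp_add]
    refine Real.exp_le_exp.2 ?_
    push_cast
    have : (j : ℝ) ≤ (j : ℝ) ^ 2 := by
      have : j ≤ j ^ 2 := Nat.le_self_pow (by norm_num) j
      exact_mod_cast this
    nlinarith
  calc _ ≤ ((j : ℝ) + 1) ^ M * (Real.exp κ * Real.exp (-κ * ((j + 1 : ℕ) : ℝ))) :=
        mul_le_mul e1 e2 (Real.exp_pos _).le (by positivity)
    _ = _ := by push_cast; ring

lemma peel {d : ℕ} (α C0 κ : ℝ) (hC0 : 0 < C0) (hκ : 0 < κ) :
    ∃ C3 : ℝ, 0 < C3 ∧ ∀ (PX : Measure (Euc d)) (η : Euc d → ℝ), IsProbabilityMeasure PX →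
      Measurable η → Margin PX η α C0 → ∀ δ0 : ℝ, 0 < δ0 →
      ∫ x, |η x - 1 / 2| * Real.exp (-(κ * (|η x - 1 / 2| / δ0) ^ 2)) ∂PX ≤
        C3 * δ0 ^ (1 + α) := by
  set b : ℕ → ℝ := fun j => ((j : ℝ) + 1) ^ (1 + α) * Real.exp (-(κ * (j : ℝ) ^ 2)) with hb
  have hbs : Summable b := summable_peel α κ hκ
  have hb0 : ∀ j, 0 < b j := fun j => by positivity
  have hbt : 0 < ∑' j, b j := hbs.tsum_pos (fun j => (hb0 j).le) 0 (hb0 0)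
  refine ⟨C0 * ∑' j, b j, by positivity, ?_⟩
  intro PX η hP hη hM δ0 hδ0
  have hum : Measurable fun x => |η x - 1 / 2| := by fun_prop
  have hS : ∀ j : ℕ, MeasurableSet
      {x | 0 < |η x - 1 / 2| ∧ |η x - 1 / 2| ≤ ((j : ℝ) + 1) * δ0} := fun j =>
    (measurableSet_lt measurable_const hum).inter (measurableSet_le hum measurable_const)
  rw [integral_eq_lintegral_of_nonneg_ae (ae_of_all _ fun x => by positivity)
    (by fun_prop)]
  refine ENNReal.toReal_le_of_le_ofReal (by positivity) ?_
  have hpt : ∀ x, ENNReal.ofReal (|η x - 1 / 2| * Real.exp (-(κ * (|η x - 1 / 2| / δ0) ^ 2))) ≤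
      ∑' j : ℕ, ({x | 0 < |η x - 1 / 2| ∧ |η x - 1 / 2| ≤ ((j : ℝ) + 1) * δ0}).indicator
        (fun _ => ENNReal.ofReal (δ0 * ((j : ℝ) + 1) * Real.exp (-(κ * (j : ℝ) ^ 2)))) x := by
    intro x
    set u := |η x - 1 / 2| with hu
    rcases (abs_nonneg (η x - 1 / 2)).eq_or_lt with h0 | h0
    · rw [hu, ← h0]; simp
    rw [← hu] at h0
    have hs0 : 0 < u / δ0 := by positivity
    obtain ⟨j, hj⟩ : ∃ j : ℕ, ⌈u / δ0⌉₊ = j + 1 :=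
      ⟨⌈u / δ0⌉₊ - 1, by have := Nat.ceil_pos.2 hs0; omega⟩
    have hle : u / δ0 ≤ (j : ℝ) + 1 := by
      have := Nat.le_ceil (u / δ0); rw [hj] at this; exact_mod_cast this
    have hlt : (j : ℝ) ≤ u / δ0 := by
      have := Nat.ceil_lt_add_one hs0.le
      rw [hj] at this; push_cast at this; linarith
    have hule : u ≤ ((j : ℝ) + 1) * δ0 := (div_le_iff₀ hδ0).1 hle
    refine le_trans ?_ (ENNReal.le_tsum j)
    rw [indicator_of_mem (show x ∈ {x | 0 < |η x - 1 / 2| ∧ |η x - 1 / 2| ≤ ((j : ℝ) + 1) * δ0}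
      from ⟨h0, hule⟩)]
    refine ENNReal.ofReal_le_ofReal ?_
    refine mul_le_mul (by linarith) (Real.exp_le_exp.2 ?_) (Real.exp_pos _).le (by positivity)
    have : (j : ℝ) ^ 2 ≤ (u / δ0) ^ 2 := by gcongr
    nlinarith
  calc _ ≤ ∫⁻ x, ∑' j : ℕ, ({x | 0 < |η x - 1 / 2| ∧ |η x - 1 / 2| ≤ ((j : ℝ) + 1) * δ0}).indicator
        (fun _ => ENNReal.ofReal (δ0 * ((j : ℝ) + 1) * Real.exp (-(κ * (j : ℝ) ^ 2)))) x ∂PX :=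
        lintegral_mono hpt
    _ = ∑' j : ℕ, ENNReal.ofReal (δ0 * ((j : ℝ) + 1) * Real.exp (-(κ * (j : ℝ) ^ 2))) *
          PX {x | 0 < |η x - 1 / 2| ∧ |η x - 1 / 2| ≤ ((j : ℝ) + 1) * δ0} := by
        rw [lintegral_tsum fun j => (measurable_const.indicator (hS j)).aemeasurable]
        refine tsum_congr fun j => ?_
        rw [lintegral_indicator_const (hS j)]
    _ ≤ ∑' j : ℕ, ENNReal.ofReal (C0 * δ0 ^ (1 + α) * b j) := by
        refine ENNReal.tsum_le_tsum fun j => ?_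
        refine (mul_le_mul_right (hM (((j : ℝ) + 1) * δ0) (by positivity)) _).trans ?_
        rw [← ENNReal.ofReal_mul (by positivity)]
        refine ENNReal.ofReal_le_ofReal (le_of_eq ?_)
        rw [hb, Real.mul_rpow (by positivity) hδ0.le]
        simp only
        rw [Real.rpow_add hδ0, Real.rpow_add (by positivity : (0 : ℝ) < (j : ℝ) + 1), Real.rpow_one,
          Real.rpow_one]
        ring
    _ = ENNReal.ofReal (∑' j, C0 * δ0 ^ (1 + α) * b j) := by
        rw [ENNReal.ofReal_tsum_of_nonneg (fun j => by positivity) (hbs.mul_left _)]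
    _ ≤ _ := by
        rw [tsum_mul_left]
        refine ENNReal.ofReal_le_ofReal (le_of_eq ?_)
        ring

/-- Comparison of the excess risk with the pointwise deviations. -/
lemma excess_le {d n : ℕ} (PX : Measure (Euc d)) [IsProbabilityMeasure PX] (η : Euc d → ℝ)
    (hη : Measurable η) (h01 : ∀ x, η x ∈ Icc (0 : ℝ) 1) (hat : Sample d n → Euc d → ℝ)
    (hhat : Measurable (Function.uncurry hat)) (B : Euc d → ℝ)
    (hBi : Integrable (fun x => 2 * |η x - 1 / 2| * B x) PX)
    (hB : ∀ᵐ x ∂PX, 0 < |η x - 1 / 2| →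
      (sampleLaw PX η n).real {ω | |η x - 1 / 2| ≤ |hat ω x - η x|} ≤ B x) :
    expExcess PX η hat ≤ ∫ x, 2 * |η x - 1 / 2| * B x ∂PX := by
  have hjp := jointLaw_prob PX η hη h01
  have hsp : IsProbabilityMeasure (sampleLaw PX η n) := by
    unfold sampleLaw; infer_instance
  set Q := sampleLaw PX η n with hQ
  set l1 : Sample d n × Euc d → ℝ := fun p => if 1 / 2 ≤ hat p.1 p.2 then 1 - η p.2 else η p.2
    with hl1
  set l2 : Euc d → ℝ := fun x => if 1 / 2 ≤ η x then 1 - η x else η x with hl2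
  have hl1m : Measurable l1 := by
    refine Measurable.ite (measurableSet_le measurable_const hhat) ?_ ?_
    · exact measurable_const.sub (hη.comp measurable_snd)
    · exact hη.comp measurable_snd
  have hl2m : Measurable l2 :=
    Measurable.ite (measurableSet_le measurable_const hη) (measurable_const.sub hη) hη
  have hl1b : ∀ p, ‖l1 p‖ ≤ 1 := by
    intro p
    have := h01 p.2
    simp only [hl1]
    rw [Real.norm_eq_abs, abs_le]
    split_ifs <;> constructor <;> linarith [this.1, this.2]
  have hl2b : ∀ p, ‖l2 p‖ ≤ 1 := by
    intro p
    have := h01 p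
    simp only [hl2]
    rw [Real.norm_eq_abs, abs_le]
    split_ifs <;> constructor <;> linarith [this.1, this.2]
  have hl1i : Integrable l1 (Q.prod PX) :=
    Integrable.of_bound hl1m.aestronglyMeasurable 1 (ae_of_all _ hl1b)
  have hl2i : Integrable l2 PX :=
    Integrable.of_bound hl2m.aestronglyMeasurable 1 (ae_of_all _ hl2b)
  have e1 : ∫ ω, risk PX η (plugin (hat ω)) ∂Q = ∫ x, ∫ ω, l1 (ω, x) ∂Q ∂PX := by
    rw [← integral_integral_swap (f := fun ω x => l1 (ω, x)) hl1i]
    simp [risk, plugin, hl1]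
  have e2 : risk PX η (bayes η) = ∫ x, l2 x ∂PX := by
    simp [risk, bayes, hl2]
  have hint : Integrable (fun x => ∫ ω, l1 (ω, x) ∂Q) PX := hl1i.integral_prod_right
  rw [expExcess, e1, e2, ← integral_sub hint hl2i]
  refine integral_mono_ae (hint.sub hl2i) hBi ?_
  filter_upwards [hB] with x hx
  set u := |η x - 1 / 2| with hu
  have hu0 : 0 ≤ u := abs_nonneg _
  set S : Set (Sample d n) := {ω | u ≤ |hat ω x - η x|} with hS
  have hhx : Measurable fun ω => hat ω x := by
    have h1 : Measurable fun ω : Sample d n => (ω, x) := measurable_prodMk_right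
    have h2 := hhat.comp h1
    exact h2
  have hSm : MeasurableSet S :=
    measurableSet_le measurable_const ((hhx.sub measurable_const).norm)
  have hpt : ∀ ω, l1 (ω, x) ≤ l2 x + 2 * u * S.indicator (fun _ => (1 : ℝ)) ω := by
    intro ω
    have hin : 0 ≤ S.indicator (fun _ => (1 : ℝ)) ω := by
      by_cases h : ω ∈ S <;> simp [h]
    have hmul : 0 ≤ 2 * u * S.indicator (fun _ => (1 : ℝ)) ω := by positivity
    simp only [hl1, hl2]
    split_ifs with ha hb' hb'
    · linarith
    · have hmem : ω ∈ S := by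
        change u ≤ |hat ω x - η x|
        rw [hu, abs_of_neg (by linarith : η x - 1 / 2 < 0)]
        exact le_trans (by linarith) (le_abs_self _)
      rw [indicator_of_mem hmem, hu, abs_of_neg (by linarith : η x - 1 / 2 < 0)]
      linarith
    · have hmem : ω ∈ S := by
        change u ≤ |hat ω x - η x|
        rw [hu, abs_of_nonneg (by linarith : 0 ≤ η x - 1 / 2), abs_sub_comm]
        exact le_trans (by linarith) (le_abs_self _)
      rw [indicator_of_mem hmem, hu, abs_of_nonneg (by linarith : 0 ≤ η x - 1 / 2)]
      linarith
    · linarith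
  have hI1 : Integrable (fun ω => l1 (ω, x)) Q := by
    have h1 : Measurable fun ω : Sample d n => (ω, x) := measurable_prodMk_right
    have h2 := hl1m.comp h1
    exact Integrable.of_bound h2.aestronglyMeasurable 1 (ae_of_all _ fun ω => hl1b _)
  have hI2 : Integrable (S.indicator (fun _ => (1 : ℝ))) Q :=
    (integrable_const 1).indicator hSm
  have hI3 : Integrable (fun ω => l2 x + 2 * u * S.indicator (fun _ => (1 : ℝ)) ω) Q :=
    (integrable_const _).add (hI2.const_mul _)
  have hle := integral_mono hI1 hI3 hpt
  rw [integral_add (integrable_const _) (hI2.const_mul _), integral_const_mul] at hle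
  have hone : ∫ ω, S.indicator (fun _ => (1 : ℝ)) ω ∂Q = Q.real S := integral_indicator_one hSm
  rw [hone] at hle
  simp only [integral_const, probReal_univ, one_smul] at hle
  have hlast : 2 * u * Q.real S ≤ 2 * u * B x := by
    rcases hu0.eq_or_lt with h0 | h0
    · rw [← h0]; simp
    · have := hx h0
      gcongr
  linarith

/-- Theorem 3.3. There is a plug-in classifier whose excess risk over
the class `P_Σ(α, C0, β, L, c0, r0, μmin, μmax, K)` is at most
`C n^{-β(1+α)/(2β+d)}` for all `n ≥ 1`. -/
theorem stmt2 (d : ℕ) (hd : 1 ≤ d) (α C0 β L c0 r0 μmin μmax : ℝ) (hα : 0 ≤ α)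
    (hC0 : 0 < C0) (hβ : 0 < β) (hL : 0 < L) (hc0 : 0 < c0) (hr0 : 0 < r0)
    (hμmin : 0 < μmin) (hμ : μmin ≤ μmax) (K : Set (Euc d)) (hK : IsCompact K) :
    ∃ C : ℝ, 0 < C ∧
      ∃ hatη : (n : ℕ) → Sample d n → Euc d → ℝ,
        (∀ n, Measurable (Function.uncurry (hatη n))) ∧
        (∀ n ω x, hatη n ω x ∈ Icc (0 : ℝ) 1) ∧
        ∀ (PX : Measure (Euc d)) (η : Euc d → ℝ),
          MemPS α C0 β L c0 r0 μmin μmax K PX η →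
          ∀ n, 1 ≤ n →
            expExcess PX η (hatη n) ≤ C * (n : ℝ) ^ (-(β * (1 + α)) / (2 * β + d)) := by
  classical
  obtain ⟨C1, C2, Cb, hC1, hC2, hCb, hprob⟩ :=
    prob_bound d β L c0 r0 μmin μmax hβ hL hc0 hμmin hμ
  set κ : ℝ := C2 * r0 ^ d with hκ
  have hκ0 : 0 < κ := by positivity
  obtain ⟨C3, hC3, hpeel⟩ := peel (d := d) α C0 κ hC0 hκ0
  set C1' : ℝ := C1 + Real.exp (κ * (Cb * r0 ^ β) ^ 2) with hC1'
  have hC1'0 : 0 < C1' := by positivity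
  have hden : (0 : ℝ) < 2 * β + d := by positivity
  refine ⟨2 * C1' * C3, by positivity,
    fun n => lpec (⌈β⌉₊ - 1) (r0 * (n : ℝ) ^ (-1 / (2 * β + d))), ?_, ?_, ?_⟩
  · exact fun n => measurable_lpec n _ _
  · intro n ω x
    exact ⟨le_max_left _ _, max_le zero_le_one (min_le_left _ _)⟩
  intro PX η hmem n hn
  obtain ⟨hPXp, hη, h01, hM, hH, A, hAc, -, hreg, μ, hμm, hμA, hμ0, hPX⟩ := hmem
  have hn0 : (0 : ℝ) < n := by exact_mod_cast hn
  have hn1 : (1 : ℝ) ≤ n := by exact_mod_cast hn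
  set h : ℝ := r0 * (n : ℝ) ^ (-1 / (2 * β + d)) with hh
  have hh0 : 0 < h := by positivity
  have hhr : h ≤ r0 := by
    have : (n : ℝ) ^ (-1 / (2 * β + d)) ≤ 1 :=
      Real.rpow_le_one_of_one_le_of_nonpos hn1
        (div_nonpos_of_nonpos_of_nonneg (by norm_num) hden.le)
    calc h ≤ r0 * 1 := by rw [hh]; gcongr
      _ = r0 := mul_one _
  set δ0 : ℝ := (n : ℝ) ^ (-β / (2 * β + d)) with hδ0
  have hδ00 : 0 < δ0 := by positivity
  have hhβ : h ^ β = r0 ^ β * δ0 := by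
    rw [hh, Real.mul_rpow hr0.le (by positivity), ← Real.rpow_mul hn0.le, hδ0]
    congr 2; ring
  have hnh : n * h ^ d = r0 ^ d * (1 / δ0 ^ 2) := by
    have e1 : 1 / δ0 ^ 2 = (n : ℝ) ^ (2 * β / (2 * β + d)) := by
      rw [hδ0, ← Real.rpow_natCast, ← Real.rpow_mul hn0.le, one_div, ← Real.rpow_neg hn0.le]
      congr 1; push_cast; ring
    have e2 : ((n : ℝ) ^ (-1 / (2 * β + d))) ^ d = (n : ℝ) ^ (-(d : ℝ) / (2 * β + d)) := by
      rw [← Real.rpow_natCast, ← Real.rpow_mul hn0.le]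
      congr 1; ring
    have e3 : (n : ℝ) ^ (2 * β / (2 * β + d)) = n * (n : ℝ) ^ (-(d : ℝ) / (2 * β + d)) := by
      conv_rhs => rw [← Real.rpow_one (n : ℝ)]
      rw [Real.rpow_one, ← Real.rpow_one_add' hn0.le]
      · congr 1; field_simp; ring
      · have : 1 + -(d : ℝ) / (2 * β + d) = 2 * β / (2 * β + d) := by field_simp; ring
        rw [this]; positivity
    rw [e1, e3, hh, mul_pow, e2]; ring
  have hrate : δ0 ^ (1 + α) = (n : ℝ) ^ (-(β * (1 + α)) / (2 * β + d)) := by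
    rw [hδ0, ← Real.rpow_mul hn0.le]
    congr 1; ring
  have hdev : ∀ x ∈ A, ∀ δ : ℝ, 0 < δ → δ ≤ 1 →
      (sampleLaw PX η n).real {ω | δ ≤ |lpec (⌈β⌉₊ - 1) h ω x - η x|} ≤
        C1' * Real.exp (-(κ * (δ / δ0) ^ 2)) := by
    intro x hx δ hδ hδ1
    by_cases hcase : Cb * h ^ β ≤ δ
    · refine (hprob PX η hPXp hη h01 hH A μ hAc hreg hμA hμ0 hPX x hx h hh0 hhr n hn δ hδ hδ1
        hcase).trans ?_
      have e : C2 * (n * h ^ d) * δ ^ 2 = κ * (δ / δ0) ^ 2 := by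
        rw [hnh, hκ]; field_simp
      rw [e]
      gcongr
      rw [hC1']
      linarith [Real.exp_pos (κ * (Cb * r0 ^ β) ^ 2)]
    · have hjp := jointLaw_prob PX η hη h01
      have hsp : IsProbabilityMeasure (sampleLaw PX η n) := by
        unfold sampleLaw; infer_instance
      refine measureReal_le_one.trans ?_
      have hlt : δ / δ0 ≤ Cb * r0 ^ β := by
        rw [div_le_iff₀ hδ00, mul_assoc, ← hhβ]
        exact (not_le.1 hcase).le
      have hsq : (δ / δ0) ^ 2 ≤ (Cb * r0 ^ β) ^ 2 := by gcongr
      calc (1 : ℝ) = Real.exp (κ * (Cb * r0 ^ β) ^ 2) * Real.exp (-(κ * (Cb * r0 ^ β) ^ 2)) := by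
            rw [← Real.exp_add]; simp
        _ ≤ C1' * Real.exp (-(κ * (δ / δ0) ^ 2)) := by
            refine mul_le_mul (by rw [hC1']; linarith) (Real.exp_le_exp.2 ?_) (Real.exp_pos _).le
              hC1'0.le
            have := mul_le_mul_of_nonneg_left hsq hκ0.le
            linarith
  have hAae : ∀ᵐ x ∂PX, x ∈ A := by
    rw [ae_iff]
    have e : {x | ¬ x ∈ A} = Aᶜ := rfl
    rw [e, hPX, withDensity_apply _ hAc.measurableSet.compl]
    rw [setLIntegral_congr_fun (g := fun _ => 0) hAc.measurableSet.compl]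
    · simp
    · intro x hx
      simp [hμ0 x hx]
  have hu1 : ∀ x, |η x - 1 / 2| ≤ 1 := by
    intro x
    have := h01 x
    rw [abs_le]
    constructor <;> linarith [this.1, this.2]
  have hexc := excess_le PX η hη h01 (lpec (⌈β⌉₊ - 1) h) (measurable_lpec n _ _)
    (fun x => C1' * Real.exp (-(κ * (|η x - 1 / 2| / δ0) ^ 2))) ?_ ?_
  · refine hexc.trans ?_
    have e : ∀ x, 2 * |η x - 1 / 2| * (C1' * Real.exp (-(κ * (|η x - 1 / 2| / δ0) ^ 2))) =
        2 * C1' * (|η x - 1 / 2| * Real.exp (-(κ * (|η x - 1 / 2| / δ0) ^ 2))) := fun x => by ring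
    simp_rw [e]
    rw [integral_const_mul, ← hrate, mul_assoc (2 * C1')]
    exact mul_le_mul_of_nonneg_left (hpeel PX η hPXp hη hM δ0 hδ00) (by positivity)
  · refine Integrable.of_bound (C := 2 * 1 * (C1' * 1)) (by fun_prop) (ae_of_all _ fun x => ?_)
    rw [Real.norm_eq_abs, abs_of_nonneg (by positivity)]
    have he : Real.exp (-(κ * (|η x - 1 / 2| / δ0) ^ 2)) ≤ 1 :=
      Real.exp_le_one_iff.2 (by have : 0 ≤ κ * (|η x - 1 / 2| / δ0) ^ 2 := by positivity
                                linarith)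
    have := hu1 x
    gcongr
  · filter_upwards [hAae] with x hx hpos
    exact hdev x hx _ hpos (hu1 x)

end
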